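/- Let q be an even prime power with q ≥ 2048, and let K be a complete k-cap in PG(4, q) with k ≥ q³ − 2q² + 3q√q + 8q − 9√q − 6. Then there exists no hyperplane δ of PG(4, q) such that q² − 2q + 3√q + 2 ≤ |δ ∩ K| < q² + 1. -/

import Mathlib

open Module

/-- Points of the projective space `PG(n, q)` over the field `F` (with `q = |F|`). -/
abbrev PGPoint (F : Type*) [Field F] (n : ℕ) := Projectivization F (Fin (n + 1) → F)

/-- The set of projective points lying in the projective subspace determined by
a linear subspace `W`. -/
def ptsIn {F : Type*} [Field F] {n : ℕ} (W : Submodule F (Fin (n + 1) → F)) :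
    Set (PGPoint F n) := {P | P.submodule ≤ W}

/-- Three points of `PG(n, q)` are collinear if they lie on a common line. -/
def Coll3 {F : Type*} [Field F] {n : ℕ} (P₁ P₂ P₃ : PGPoint F n) : Prop :=
  Module.finrank F ↥(P₁.submodule ⊔ P₂.submodule ⊔ P₃.submodule) ≤ 2

/-- A cap (a plane arc when `n = 2`): a set of points no three of which are collinear. -/
def IsCap {F : Type*} [Field F] {n : ℕ} (K : Set (PGPoint F n)) : Prop :=
  ∀ P₁ ∈ K, ∀ P₂ ∈ K, ∀ P₃ ∈ K, P₁ ≠ P₂ → P₁ ≠ P₃ → P₂ ≠ P₃ → ¬ Coll3 P₁ P₂ P₃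

/-- A complete cap: a cap that is not contained in a cap with one more point. -/
def IsCompleteCap {F : Type*} [Field F] {n : ℕ} (K : Set (PGPoint F n)) : Prop :=
  IsCap K ∧ ∀ P ∉ K, ¬ IsCap (insert P K)

/-- A tangent line of `K`: a line (2-dimensional linear subspace) meeting `K`
in exactly one point. -/
def IsTangent {F : Type*} [Field F] {n : ℕ} (K : Set (PGPoint F n))
    (W : Submodule F (Fin (n + 1) → F)) : Prop :=
  Module.finrank F W = 2 ∧ (ptsIn W ∩ K).ncard = 1

set_option linter.unusedSectionVars false

/-- explicit three by three determinant -/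
def det3 {F : Type*} [Field F] (x y z : Fin 3 → F) : F :=
  x 0 * (y 1 * z 2 - y 2 * z 1) - x 1 * (y 0 * z 2 - y 2 * z 0) + x 2 * (y 0 * z 1 - y 1 * z 0)

section planeArc
variable {F : Type*} [Field F]

theorem det3_pl (b w x a c : Fin 3 → F) :
    det3 b w x * det3 b a c = det3 b w c * det3 b a x - det3 b w a * det3 b c x := by
  unfold det3; ring

theorem det3_swap23 (x y z : Fin 3 → F) : det3 x y z = - det3 x z y := by
  unfold det3; ring

theorem det3_swap13 (x y z : Fin 3 → F) : det3 x y z = - det3 z y x := by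
  unfold det3; ring

theorem det3_self23 (x y : Fin 3 → F) : det3 x y y = 0 := by
  unfold det3; ring

theorem det3_self13 (x y : Fin 3 → F) : det3 x y x = 0 := by
  unfold det3; ring

theorem det3_self12 (x y : Fin 3 → F) : det3 x x y = 0 := by
  unfold det3; ring

open Classical in
/-- vanishing divided difference -/
theorem divdiff (b : Fin 3 → F) (D : Finset (Fin 3 → F)) :
    ∀ M : Finset (Fin 3 → F), (∀ x ∈ M, ∀ y ∈ M, x ≠ y → det3 b x y ≠ 0) →
      M.card = D.card + 2 →
      ∑ x ∈ M, (∏ w ∈ D, det3 b w x) / (∏ e ∈ M.erase x, det3 b e x) = 0 := by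
  induction D using Finset.induction_on with
  | empty =>
    intro M hM hc
    simp only [Finset.card_empty, zero_add] at hc
    obtain ⟨x, y, hxy, rfl⟩ := Finset.card_eq_two.1 hc
    rw [Finset.sum_pair hxy]
    have h1 : ({x, y} : Finset (Fin 3 → F)).erase x = {y} := by
      ext z; simp only [Finset.mem_erase, Finset.mem_insert, Finset.mem_singleton]; grind
    have h2 : ({x, y} : Finset (Fin 3 → F)).erase y = {x} := by
      ext z; simp only [Finset.mem_erase, Finset.mem_insert, Finset.mem_singleton]; grind
    rw [h1, h2]
    simp only [Finset.prod_empty, Finset.prod_singleton]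
    rw [det3_swap23 b y x, one_div, one_div, inv_neg]; ring
  | insert w D hw ih =>
    intro M hM hc
    rw [Finset.card_insert_of_notMem hw] at hc
    obtain ⟨a, ha, c, hcM, hac⟩ := Finset.one_lt_card.1 (show 1 < M.card by omega)
    have hne := hM a ha c hcM hac
    have hA := ih (M.erase a) (fun x hx y hy => hM x (Finset.mem_of_mem_erase hx) y (Finset.mem_of_mem_erase hy))
      (by rw [Finset.card_erase_of_mem ha]; omega)
    have hC := ih (M.erase c) (fun x hx y hy => hM x (Finset.mem_of_mem_erase hx) y (Finset.mem_of_mem_erase hy))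
      (by rw [Finset.card_erase_of_mem hcM]; omega)
    have key : ∀ a ∈ M, ∑ x ∈ M, det3 b a x * ((∏ w ∈ D, det3 b w x) / (∏ e ∈ M.erase x, det3 b e x))
        = ∑ x ∈ M.erase a, (∏ w ∈ D, det3 b w x) / (∏ e ∈ (M.erase a).erase x, det3 b e x) := by
      intro a ha
      rw [← Finset.add_sum_erase M _ ha, det3_self23, zero_mul, zero_add]
      apply Finset.sum_congr rfl
      intro x hx
      have hxa := Finset.ne_of_mem_erase hx
      have hax : a ∈ M.erase x := Finset.mem_erase.2 ⟨hxa.symm, ha⟩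
      rw [← Finset.mul_prod_erase _ _ hax, Finset.erase_right_comm]
      have := hM a ha x (Finset.mem_of_mem_erase hx) hxa.symm
      rw [← mul_div_assoc, mul_div_mul_left _ _ this]
    have h2 : det3 b a c * ∑ x ∈ M, (∏ w ∈ insert w D, det3 b w x) / (∏ e ∈ M.erase x, det3 b e x)
        = det3 b w c * ∑ x ∈ M, det3 b a x * ((∏ w ∈ D, det3 b w x) / (∏ e ∈ M.erase x, det3 b e x))
        - det3 b w a * ∑ x ∈ M, det3 b c x * ((∏ w ∈ D, det3 b w x) / (∏ e ∈ M.erase x, det3 b e x)) := by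
      rw [Finset.mul_sum, Finset.mul_sum, Finset.mul_sum, ← Finset.sum_sub_distrib]
      apply Finset.sum_congr rfl
      intro x hx
      rw [Finset.prod_insert hw]
      have := det3_pl b w x a c
      linear_combination ((∏ w ∈ D, det3 b w x) / (∏ e ∈ M.erase x, det3 b e x)) * this
    rw [key a ha, key c hcM, hA, hC] at h2
    simpa [hne] using h2

/-- directions of tangents at a point of an arc -/
structure TanDir [Fintype F] (A : Finset (Fin 3 → F)) (a : Fin 3 → F) (D : Finset (Fin 3 → F)) : Prop where
  card : D.card + A.card = Fintype.card F + 2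
  pw : ∀ w ∈ D, ∀ w' ∈ D, w ≠ w' → det3 a w w' ≠ 0
  arc : ∀ w ∈ D, ∀ e ∈ A, e ≠ a → det3 a w e ≠ 0
  tan : ∀ y, (∀ e ∈ A, e ≠ a → det3 a e y ≠ 0) → ∃ w ∈ D, det3 a w y = 0

theorem det3_add_smul (a c b x : Fin 3 → F) (s : F) :
    det3 a (c + s • b) x = det3 a c x + s * det3 a b x := by
  unfold det3; simp only [Pi.add_apply, Pi.smul_apply, smul_eq_mul]; ring

theorem det3_add_smul' (a c b x : Fin 3 → F) (s : F) :
    det3 a x (c + s • b) = det3 a x c + s * det3 a x b := by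
  unfold det3; simp only [Pi.add_apply, Pi.smul_apply, smul_eq_mul]; ring

open Classical in
theorem exists_tanDir [Fintype F] (A : Finset (Fin 3 → F))
    (hA : ∀ x ∈ A, ∀ y ∈ A, ∀ z ∈ A, x ≠ y → x ≠ z → y ≠ z → det3 x y z ≠ 0)
    (hcard : 3 ≤ A.card) (a : Fin 3 → F) (ha : a ∈ A) : ∃ D, TanDir A a D := by
  obtain ⟨b, hb, hba⟩ : ∃ b ∈ A, b ≠ a := Finset.exists_mem_ne (by omega) a
  obtain ⟨c, hc, hcc⟩ : ∃ c ∈ A.erase a, c ≠ b :=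
    Finset.exists_mem_ne (by rw [Finset.card_erase_of_mem ha]; omega) b
  have hca := Finset.ne_of_mem_erase hc
  have hcA := Finset.mem_of_mem_erase hc
  have habc : det3 a b c ≠ 0 := hA a ha b hb c hcA hba.symm hca.symm hcc.symm
  have hcb : det3 a c b ≠ 0 := by rw [det3_swap23]; exact neg_ne_zero.2 habc
  have hWb : ∀ s : F, det3 a (c + s • b) b = det3 a c b := by
    intro s; rw [det3_add_smul, det3_self23]; ring
  set E := (A.erase a).erase b with hE
  have hEab : ∀ e ∈ E, det3 a b e ≠ 0 := by
    intro e he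
    simp only [hE, Finset.mem_erase] at he
    exact hA a ha b hb e he.2.2 hba.symm (Ne.symm he.2.1) (Ne.symm he.1)
  let σ : (Fin 3 → F) → F := fun e => - det3 a c e / det3 a b e
  have hσ : ∀ e ∈ E, ∀ s, det3 a (c + s • b) e = 0 ↔ s = σ e := by
    intro e he s
    have := hEab e he
    rw [det3_add_smul]
    simp only [σ]
    rw [eq_div_iff this]
    constructor <;> intro h <;> linear_combination h
  have hinj : Set.InjOn σ E := by
    intro e he e' he' hee
    by_contra hne
    have h1 := (hσ e he (σ e)).2 rfl
    have h2 := (hσ e' he' (σ e)).2 hee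
    have he2 := he; have he2' := he'
    simp only [hE, Finset.coe_erase, Finset.mem_coe, Set.mem_sdiff, Set.mem_singleton_iff] at he2 he2'
    have h3 := hA a ha e (by tauto) e' (by tauto) (by tauto) (by tauto) hne
    have h4 := det3_pl a (c + σ e • b) b e e'
    rw [h1, h2, hWb] at h4
    simp only [zero_mul, sub_zero, mul_eq_zero] at h4
    tauto
  let T : Finset F := Finset.univ \ E.image σ
  have hcinj : Function.Injective (fun s : F => c + s • b) := by
    intro s s' h
    have h := congrArg (fun w => det3 a w c) h
    simp only [det3_add_smul] at h
    exact mul_right_cancel₀ habc (add_left_cancel h)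
  have hT : ∀ s ∈ T, ∀ e ∈ E, s ≠ σ e := by
    intro s hs e he h
    simp only [T, Finset.mem_sdiff, Finset.mem_univ, true_and, Finset.mem_image, not_exists, not_and] at hs
    exact hs e he h.symm
  refine ⟨T.image (fun s => c + s • b), ?_, ?_, ?_, ?_⟩
  · rw [Finset.card_image_of_injective _ hcinj]
    have h1 : T.card = Fintype.card F - (E.image σ).card := by
      simp only [T]
      rw [Finset.card_sdiff_of_subset (Finset.subset_univ _), Finset.card_univ]
    have h2 : (E.image σ).card ≤ Fintype.card F := Finset.card_le_univ _
    rw [Finset.card_image_of_injOn hinj] at h1 h2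
    have h3 : E.card = A.card - 1 - 1 := by
      rw [hE, Finset.card_erase_of_mem (Finset.mem_erase.2 ⟨hba, hb⟩), Finset.card_erase_of_mem ha]
    omega
  · intro w hw w' hw' hne
    obtain ⟨s, hs, rfl⟩ := Finset.mem_image.1 hw
    obtain ⟨s', hs', rfl⟩ := Finset.mem_image.1 hw'
    have hss : s - s' ≠ 0 := by
      intro h
      exact hne (by rw [sub_eq_zero.1 h])
    have : det3 a (c + s • b) (c + s' • b) = (s - s') * det3 a b c := by
      rw [det3_add_smul, det3_add_smul', det3_add_smul', det3_self23, det3_self23, det3_swap23 a c b]; ring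
    rw [this]
    exact mul_ne_zero hss habc
  · intro w hw e he hea
    obtain ⟨s, hs, rfl⟩ := Finset.mem_image.1 hw
    by_cases heb : e = b
    · rw [heb, hWb]; exact hcb
    · have heE : e ∈ E := by simp only [hE, Finset.mem_erase]; exact ⟨heb, hea, he⟩
      intro h
      exact hT s hs e heE ((hσ e heE s).1 h)
  · intro y hy
    have hby := hy b hb hba
    refine ⟨c + (- det3 a c y / det3 a b y) • b, ?_, ?_⟩
    · apply Finset.mem_image_of_mem
      simp only [T, Finset.mem_sdiff, Finset.mem_univ, true_and, Finset.mem_image, not_exists, not_and]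
      intro e he h
      have h1 := (hσ e he (- det3 a c y / det3 a b y)).2 h.symm
      have h2 : det3 a (c + (- det3 a c y / det3 a b y) • b) y = 0 := by
        rw [det3_add_smul]; field_simp; ring
      have h4 := det3_pl a (c + (- det3 a c y / det3 a b y) • b) b e y
      rw [h1, h2, hWb] at h4
      simp only [zero_mul, sub_zero, mul_eq_zero] at h4
      simp only [hE, Finset.mem_erase] at he
      have := hy e he.2.2 he.2.1
      tauto
    · rw [det3_add_smul]; field_simp; ring

theorem det3_symm13 [CharP F 2] (x y z : Fin 3 → F) : det3 x y z = det3 z y x := by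
  rw [det3_swap13, CharTwo.neg_eq]

open Classical in
theorem prod_erase_zero [Fintype F] [CharP F 2] : ∏ x ∈ (Finset.univ.erase (0 : F)), x = 1 := by
  have h := FiniteField.prod_univ_units_id_eq_neg_one (K := F)
  have h2 := congrArg (Units.coeHom F) h
  rw [map_prod] at h2
  simp only [Units.coeHom_apply, Units.val_neg, Units.val_one, CharTwo.neg_eq] at h2
  rw [← h2]
  symm
  refine Finset.prod_bij (fun u _ => (u : F)) ?_ ?_ ?_ ?_
  · intro u _; simp
  · intro u _ u' _ h; exact Units.ext h
  · intro x hx; exact ⟨Units.mk0 x (Finset.ne_of_mem_erase hx), Finset.mem_univ _, rfl⟩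
  · intro u _; rfl

open Classical in
theorem pencil_prod [Fintype F] [CharP F 2] (A : Finset (Fin 3 → F))
    (hA : ∀ x ∈ A, ∀ y ∈ A, ∀ z ∈ A, x ≠ y → x ≠ z → y ≠ z → det3 x y z ≠ 0)
    (a b c : Fin 3 → F) (ha : a ∈ A) (hb : b ∈ A) (hc : c ∈ A) (hab : a ≠ b) (hac : a ≠ c) (hbc : b ≠ c)
    (D : Finset (Fin 3 → F)) (hD : TanDir A a D) (R : Finset (Fin 3 → F))
    (hR : ∀ e, e ∈ R ↔ e ∈ A ∧ e ≠ a ∧ e ≠ b ∧ e ≠ c) :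
    (∏ w ∈ D, det3 a w b) * (∏ e ∈ R, det3 a e b) = (∏ w ∈ D, det3 a w c) * (∏ e ∈ R, det3 a e c) := by
  have habc := hA a ha b hb c hc hab hac hbc
  have hdisj : Disjoint D R := by
    rw [Finset.disjoint_left]
    intro w hw hwR
    have h1 := (hR w).1 hwR
    have := hD.arc w hw w h1.1 h1.2.1
    rw [det3_self23] at this
    exact this rfl
  have hRc : R.card + 3 = A.card := by
    have : R = ((A.erase a).erase b).erase c := by
      ext e; rw [hR]; simp only [Finset.mem_erase]; tauto
    have hb' : b ∈ A.erase a := Finset.mem_erase.2 ⟨hab.symm, hb⟩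
    have hc' : c ∈ (A.erase a).erase b :=
      Finset.mem_erase.2 ⟨hbc.symm, Finset.mem_erase.2 ⟨hac.symm, hc⟩⟩
    have h1 := Finset.card_erase_add_one ha
    have h2 := Finset.card_erase_add_one hb'
    have h3 := Finset.card_erase_add_one hc'
    rw [this]; omega
  have hpw : ∀ x ∈ D ∪ R, ∀ y ∈ D ∪ R, x ≠ y → det3 a x y ≠ 0 := by
    intro x hx y hy hxy
    rcases Finset.mem_union.1 hx with hx | hx <;> rcases Finset.mem_union.1 hy with hy | hy
    · exact hD.pw x hx y hy hxy
    · have := (hR y).1 hy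
      exact hD.arc x hx y this.1 this.2.1
    · have := (hR x).1 hx
      rw [det3_swap23]
      exact neg_ne_zero.2 (hD.arc y hy x this.1 this.2.1)
    · have h1 := (hR x).1 hx
      have h2 := (hR y).1 hy
      exact hA a ha x h1.1 y h2.1 h1.2.1.symm h2.2.1.symm hxy
  have hnb : ∀ x ∈ D ∪ R, det3 a x b ≠ 0 := by
    intro x hx
    rcases Finset.mem_union.1 hx with hx | hx
    · exact hD.arc x hx b hb hab.symm
    · have h1 := (hR x).1 hx
      exact hA a ha x h1.1 b hb h1.2.1.symm hab h1.2.2.1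
  have hnc : ∀ x ∈ D ∪ R, det3 a x c ≠ 0 := by
    intro x hx
    rcases Finset.mem_union.1 hx with hx | hx
    · exact hD.arc x hx c hc hac.symm
    · have h1 := (hR x).1 hx
      exact hA a ha x h1.1 c hc h1.2.1.symm hac h1.2.2.2
  let ρ : (Fin 3 → F) → F := fun x => det3 a x b / det3 a x c
  have hinj : Set.InjOn ρ (D ∪ R : Finset (Fin 3 → F)) := by
    intro x hx y hy hxy
    by_contra hne
    have h1 := hpw x hx y hy hne
    have h2 := hnc x hx
    have h3 := hnc y hy
    simp only [ρ] at hxy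
    rw [div_eq_div_iff h2 h3] at hxy
    have h4 := det3_pl a x y b c
    rw [det3_swap23 a b y, det3_swap23 a c y] at h4
    have h5 : det3 a x y * det3 a b c = 0 := by linear_combination h4 + hxy
    simp only [mul_eq_zero] at h5
    tauto
  have himg : (D ∪ R).image ρ = Finset.univ.erase 0 := by
    apply Finset.eq_of_subset_of_card_le
    · intro x hx
      obtain ⟨y, hy, rfl⟩ := Finset.mem_image.1 hx
      exact Finset.mem_erase.2 ⟨div_ne_zero (hnb y hy) (hnc y hy), Finset.mem_univ _⟩
    · rw [Finset.card_image_of_injOn hinj, Finset.card_union_of_disjoint hdisj,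
        Finset.card_erase_of_mem (Finset.mem_univ _), Finset.card_univ]
      have := hD.card
      omega
  have hprod : ∏ x ∈ D ∪ R, ρ x = 1 := by
    rw [← prod_erase_zero (F := F), ← himg, Finset.prod_image hinj]
  simp only [ρ] at hprod
  rw [Finset.prod_div_distrib, div_eq_one_iff_eq (Finset.prod_ne_zero_iff.2 hnc),
    Finset.prod_union hdisj, Finset.prod_union hdisj] at hprod
  exact hprod

open Classical in
theorem tangents_lemma [Fintype F] [CharP F 2] (A : Finset (Fin 3 → F))
    (hA : ∀ x ∈ A, ∀ y ∈ A, ∀ z ∈ A, x ≠ y → x ≠ z → y ≠ z → det3 x y z ≠ 0)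
    (a b c : Fin 3 → F) (ha : a ∈ A) (hb : b ∈ A) (hc : c ∈ A) (hab : a ≠ b) (hac : a ≠ c) (hbc : b ≠ c)
    (Da Db Dc : Finset (Fin 3 → F)) (hDa : TanDir A a Da) (hDb : TanDir A b Db) (hDc : TanDir A c Dc) :
    (∏ w ∈ Da, det3 a w b) * (∏ w ∈ Db, det3 b w c) * (∏ w ∈ Dc, det3 c w a)
     = (∏ w ∈ Da, det3 a w c) * (∏ w ∈ Db, det3 b w a) * (∏ w ∈ Dc, det3 c w b) := by
  set R := ((A.erase a).erase b).erase c with hR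
  have hR' : ∀ e, e ∈ R ↔ e ∈ A ∧ e ≠ a ∧ e ≠ b ∧ e ≠ c := by
    intro e; simp only [hR, Finset.mem_erase]; tauto
  have h1 := pencil_prod A hA a b c ha hb hc hab hac hbc Da hDa R hR'
  have h2 := pencil_prod A hA b c a hb hc ha hbc hab.symm hac.symm Db hDb R
    (by intro e; rw [hR']; tauto)
  have h3 := pencil_prod A hA c a b hc ha hb hac.symm hbc.symm hab Dc hDc R
    (by intro e; rw [hR']; tauto)
  have e1 : ∏ e ∈ R, det3 a e b = ∏ e ∈ R, det3 b e a :=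
    Finset.prod_congr rfl fun e _ => det3_symm13 _ _ _
  have e2 : ∏ e ∈ R, det3 a e c = ∏ e ∈ R, det3 c e a :=
    Finset.prod_congr rfl fun e _ => det3_symm13 _ _ _
  have e3 : ∏ e ∈ R, det3 b e c = ∏ e ∈ R, det3 c e b :=
    Finset.prod_congr rfl fun e _ => det3_symm13 _ _ _
  have n1 : ∏ e ∈ R, det3 b e a ≠ 0 := Finset.prod_ne_zero_iff.2 fun e he => by
    have := (hR' e).1 he
    exact hA b hb e this.1 a ha this.2.2.1.symm hab.symm this.2.1
  have n2 : ∏ e ∈ R, det3 c e a ≠ 0 := Finset.prod_ne_zero_iff.2 fun e he => by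
    have := (hR' e).1 he
    exact hA c hc e this.1 a ha this.2.2.2.symm hac.symm this.2.1
  have n3 : ∏ e ∈ R, det3 c e b ≠ 0 := Finset.prod_ne_zero_iff.2 fun e he => by
    have := (hR' e).1 he
    exact hA c hc e this.1 b hb this.2.2.2.symm hbc.symm this.2.2.1
  rw [e1, e2] at h1
  rw [e3] at h2
  have n := mul_ne_zero (mul_ne_zero n1 n2) n3
  apply mul_right_cancel₀ n
  calc _ = ((∏ w ∈ Da, det3 a w b) * ∏ e ∈ R, det3 b e a) * ((∏ w ∈ Db, det3 b w c) * ∏ e ∈ R, det3 c e b)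
      * ((∏ w ∈ Dc, det3 c w a) * ∏ e ∈ R, det3 c e a) := by ring
    _ = _ := by rw [h1, h2, h3]; ring

open Classical in
/-- Key lemma: through a point on a secant there pass at most `q + 2 - |A|` tangents. -/
theorem tangents_le [Fintype F] [CharP F 2] (A : Finset (Fin 3 → F))
    (hA : ∀ x ∈ A, ∀ y ∈ A, ∀ z ∈ A, x ≠ y → x ≠ z → y ≠ z → det3 x y z ≠ 0)
    (hcard : 3 ≤ A.card) (y x1 x2 : Fin 3 → F) (hx1 : x1 ∈ A) (hx2 : x2 ∈ A) (hx : x1 ≠ x2)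
    (hy : det3 x1 x2 y = 0) :
    (A.filter (fun a => ∀ e ∈ A, e ≠ a → det3 a e y ≠ 0)).card + A.card ≤ Fintype.card F + 2 := by
  have hex : ∀ a, ∃ D, a ∈ A → TanDir A a D := by
    intro a
    by_cases ha : a ∈ A
    · obtain ⟨D, hD⟩ := exists_tanDir A hA hcard a ha
      exact ⟨D, fun _ => hD⟩
    · exact ⟨∅, fun h => absurd h ha⟩
  choose D hD using hex
  set d := (D x1).card with hd
  have hDcard : ∀ a ∈ A, (D a).card = d := by
    intro a ha
    have h1 := (hD a ha).card
    have h2 := (hD x1 hx1).card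
    omega
  have hd2 := (hD x1 hx1).card
  by_contra hcon
  have hle : d + 1 ≤ (A.filter (fun a => ∀ e ∈ A, e ≠ a → det3 a e y ≠ 0)).card := by omega
  obtain ⟨S, hS, hScard⟩ := Finset.exists_subset_card_eq hle
  have hS1 : ∀ a ∈ S, a ∈ A ∧ ∀ e ∈ A, e ≠ a → det3 a e y ≠ 0 := fun a ha => Finset.mem_filter.1 (hS ha)
  have hx1S : x1 ∉ S := fun h => (hS1 x1 h).2 x2 hx2 hx.symm hy
  -- the raw product and the rescaled one
  let g : (Fin 3 → F) → (Fin 3 → F) → F := fun b u => ∏ w ∈ D b, det3 b w u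
  have hg0 : ∀ b ∈ A, ∀ c ∈ A, c ≠ b → g b c ≠ 0 := by
    intro b hb c hc hcb
    exact Finset.prod_ne_zero_iff.2 fun w hw => (hD b hb).arc w hw c hc hcb
  let lam : (Fin 3 → F) → F := fun b => if b = x1 then 1 else g x1 b / g b x1
  have hsym : ∀ b ∈ A, ∀ c ∈ A, b ≠ c → lam b * g b c = lam c * g c b := by
    intro b hb c hc hbc
    by_cases h1 : b = x1
    · subst h1
      have h2 : c ≠ b := hbc.symm
      have := hg0 c hc b hb hbc
      simp only [lam, if_true, if_neg h2]
      field_simp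
    · by_cases h2 : c = x1
      · subst h2
        have := hg0 b hb c hc hbc.symm
        simp only [lam, if_true, if_neg h1]
        field_simp
      · simp only [lam, if_neg h1, if_neg h2]
        have n1 := hg0 b hb x1 hx1 (Ne.symm h1)
        have n2 := hg0 c hc x1 hx1 (Ne.symm h2)
        have h3 := tangents_lemma A hA x1 b c hx1 hb hc (Ne.symm h1) (Ne.symm h2) hbc _ _ _
          (hD x1 hx1) (hD b hb) (hD c hc)
        change g x1 b * g b c * g c x1 = g x1 c * g b x1 * g c b at h3
        field_simp
        linear_combination h3
  set N := insert x1 S with hN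
  have hNA : ∀ b ∈ N, b ∈ A := by
    intro b hb
    rcases Finset.mem_insert.1 hb with rfl | h
    · exact hx1
    · exact (hS1 b h).1
  have hNy : ∀ b ∈ N, ∀ c ∈ N, b ≠ c → det3 b c y ≠ 0 := by
    intro b hb c hc hbc
    rcases Finset.mem_insert.1 hb with h | h
    · rcases Finset.mem_insert.1 hc with h' | h'
      · exact absurd (h.trans h'.symm) hbc
      · have := (hS1 c h').2 b (hNA b hb) hbc
        intro h0
        apply this
        have e : det3 c b y = - det3 b c y := by unfold det3; ring
        rw [e, h0, neg_zero]
    · exact (hS1 b h).2 c (hNA c hc) hbc.symm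
  have hNcard : N.card = d + 2 := by rw [hN, Finset.card_insert_of_notMem hx1S]; omega
  have hyN : y ∉ N := by
    intro h
    obtain ⟨c, hc, hcy⟩ := Finset.exists_mem_ne (show 1 < N.card by omega) y
    exact hNy c hc y h hcy (det3_self23 _ _)
  -- the divided differences
  have hdd : ∀ b ∈ N, g b y / (∏ e ∈ N.erase b, det3 b e y) +
      ∑ c ∈ N.erase b, g b c / (det3 b y c * ∏ e ∈ (N.erase b).erase c, det3 b e c) = 0 := by
    intro b hb
    have hyb : y ∉ N.erase b := fun h => hyN (Finset.mem_of_mem_erase h)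
    have h := divdiff b (D b) (insert y (N.erase b)) ?_ ?_
    · rw [Finset.sum_insert hyb, Finset.erase_insert hyb] at h
      rw [← h]
      congr 1
      apply Finset.sum_congr rfl
      intro c hc
      have hcy : y ≠ c := fun h' => hyb (h' ▸ hc)
      rw [Finset.erase_insert_of_ne hcy, Finset.prod_insert (fun h' => hyb (Finset.mem_of_mem_erase h'))]
    · intro u hu v hv huv
      rcases Finset.mem_insert.1 hu with hu1 | hu <;> rcases Finset.mem_insert.1 hv with hv1 | hv
      · exact absurd (hu1.trans hv1.symm) huv
      · rw [det3_swap23, hu1]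
        exact neg_ne_zero.2 (hNy b hb v (Finset.mem_of_mem_erase hv) (Finset.ne_of_mem_erase hv).symm)
      · rw [hv1]
        exact hNy b hb u (Finset.mem_of_mem_erase hu) (Finset.ne_of_mem_erase hu).symm
      · exact hA b (hNA b hb) u (hNA u (Finset.mem_of_mem_erase hu)) v (hNA v (Finset.mem_of_mem_erase hv))
          (Finset.ne_of_mem_erase hu).symm (Finset.ne_of_mem_erase hv).symm huv
    · rw [Finset.card_insert_of_notMem hyb, Finset.card_erase_of_mem hb, hDcard b (hNA b hb)]
      omega
  have hsum : ∑ b ∈ N, lam b * (g b y / (∏ e ∈ N.erase b, det3 b e y)) = 0 := by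
    have h1 : ∑ b ∈ N, lam b * (g b y / (∏ e ∈ N.erase b, det3 b e y)) =
        ∑ b ∈ N, ∑ c ∈ N.erase b, lam b * (g b c / (det3 b y c * ∏ e ∈ (N.erase b).erase c, det3 b e c)) := by
      apply Finset.sum_congr rfl
      intro b hb
      rw [← Finset.mul_sum]
      congr 1
      have := hdd b hb
      rw [← CharTwo.sub_eq_add, sub_eq_zero] at this
      exact this
    rw [h1, Finset.sum_sigma']
    apply Finset.sum_involution (fun p _ => ⟨p.2, p.1⟩)
    · rintro ⟨b, c⟩ h
      simp only [Finset.mem_sigma, Finset.mem_erase] at h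
      have hs := hsym b (hNA b h.1) c (hNA c h.2.2) h.2.1.symm
      have hp : ∏ e ∈ (N.erase b).erase c, det3 b e c = ∏ e ∈ (N.erase c).erase b, det3 c e b := by
        rw [Finset.erase_right_comm]
        exact Finset.prod_congr rfl fun e _ => det3_symm13 _ _ _
      simp only
      rw [hp, det3_symm13 b y c, ← mul_div_assoc, ← mul_div_assoc, hs, CharTwo.add_self_eq_zero]
    · rintro ⟨b, c⟩ h _ h'
      simp only [Finset.mem_sigma, Finset.mem_erase] at h
      simp only [Sigma.mk.injEq] at h'
      exact h.2.1 h'.1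
    · rintro ⟨b, c⟩ h
      rfl
    · rintro ⟨b, c⟩ h
      simp only [Finset.mem_sigma, Finset.mem_erase] at h ⊢
      tauto
  rw [hN, Finset.sum_insert hx1S, Finset.sum_eq_zero (s := S), add_zero] at hsum
  · simp only [lam, if_true, one_mul] at hsum
    rw [div_eq_zero_iff] at hsum
    rcases hsum with h | h
    · obtain ⟨w, hw, hw0⟩ := Finset.prod_eq_zero_iff.1 h
      obtain ⟨a0, ha0⟩ : S.Nonempty := Finset.card_pos.1 (by omega)
      have ha0x : a0 ≠ x1 := fun h => hx1S (h ▸ ha0)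
      have h1 := (hS1 a0 ha0).2 x1 hx1 ha0x.symm
      have h2 := det3_pl x1 y a0 w x2
      rw [det3_swap23 x1 y x2, hy, det3_swap23 x1 y w, hw0] at h2
      simp only [neg_zero, zero_mul, sub_zero, mul_eq_zero] at h2
      rcases h2 with h2 | h2
      · apply h1
        have e : det3 a0 x1 y = det3 x1 y a0 := by unfold det3; ring
        rw [e, h2]
      · exact (hD x1 hx1).arc w hw x2 hx2 hx.symm h2
    · rw [Finset.prod_eq_zero_iff] at h
      obtain ⟨e, he, he0⟩ := h
      exact hNy x1 (Finset.mem_insert_self _ _) e (Finset.mem_of_mem_erase he) (Finset.ne_of_mem_erase he).symm he0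
  · intro b hb
    obtain ⟨w, hw, hw0⟩ := (hD b (hS1 b hb).1).tan y (hS1 b hb).2
    have : g b y = 0 := Finset.prod_eq_zero hw hw0
    rw [this, zero_div, mul_zero]

end planeArc

/-- a complete cap, given by representing vectors -/
structure CapSys (F : Type*) [Field F] (V : Type*) [AddCommGroup V] [Module F V] (ι : Type*)
    (v : ι → V) : Prop where
  ind : ∀ i j l, i ≠ j → i ≠ l → j ≠ l → ∀ α β γ : F, α • v i + β • v j + γ • v l = 0 →
    α = 0 ∧ β = 0 ∧ γ = 0
  ind2 : ∀ i j, i ≠ j → ∀ α β : F, α • v i + β • v j = 0 → α = 0 ∧ β = 0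
  ne : ∀ i, v i ≠ 0
  compl : ∀ y : V, (∃ i, y ∈ Submodule.span F {v i}) ∨ ∃ i j, i ≠ j ∧ y ∈ Submodule.span F {v i, v j}

/-- the line through `v i` and `y` is a tangent -/
def Tan (F : Type*) [Field F] {V : Type*} [AddCommGroup V] [Module F V] {ι : Type*}
    (v : ι → V) (i : ι) (y : V) : Prop :=
  y ∉ Submodule.span F {v i} ∧ ∀ j, j ≠ i → y ∉ Submodule.span F {v i, v j}

section cap
open Submodule
open scoped Classical
variable {F : Type*} [Field F] [Fintype F] {V : Type*} [AddCommGroup V] [Module F V] [Fintype V]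
  {ι : Type*} [Fintype ι] {v : ι → V}

theorem card_sub (U : Submodule F V) :
    ∑ y : V, (if y ∈ U then (1 : ℤ) else 0) = (Fintype.card F : ℤ) ^ Module.finrank F U := by
  rw [Finset.sum_boole]
  have h := Module.card_eq_pow_finrank (K := F) (V := U)
  rw [← Fintype.card_subtype]
  norm_cast

theorem fr1 (x : V) (hx : x ≠ 0) : Module.finrank F (span F {x}) = 1 := finrank_span_singleton hx

theorem fr2 (x y : V) (h : ∀ α β : F, α • x + β • y = 0 → α = 0 ∧ β = 0) :
    Module.finrank F (span F {x, y}) = 2 := by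
  have hl : LinearIndependent F ![x, y] := LinearIndependent.pair_iff.2 h
  have := finrank_span_eq_card hl
  have e : Set.range ![x, y] = {x, y} := by
    ext z; simp [eq_comm]; tauto
  rw [e] at this
  simpa using this

theorem fr3 (x y z : V) (h : ∀ α β γ : F, α • x + β • y + γ • z = 0 → α = 0 ∧ β = 0 ∧ γ = 0) :
    Module.finrank F (span F {x, y, z}) = 3 := by
  have hl : LinearIndependent F ![x, y, z] := by
    rw [Fintype.linearIndependent_iff]
    intro g hg
    rw [Fin.sum_univ_three] at hg
    have := h _ _ _ hg
    intro i; fin_cases i <;> simp [this]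
  have := finrank_span_eq_card hl
  have e : Set.range ![x, y, z] = {x, y, z} := by
    ext w; simp [eq_comm]; tauto
  rw [e] at this
  simpa using this

theorem line_unique (hc : CapSys F V ι v) {i j l : ι} (hij : i ≠ j) (hil : i ≠ l) (hjl : j ≠ l) {y : V}
    (h1 : y ∈ span F {v i, v j}) (h2 : y ∈ span F {v i, v l}) : y ∈ span F {v i} := by
  obtain ⟨a, b, rfl⟩ := mem_span_pair.1 h1
  obtain ⟨c, d, h⟩ := mem_span_pair.1 h2
  have := hc.ind i j l hij hil hjl (a - c) b (-d) (by
    have : a • v i + b • v j - (c • v i + d • v l) = 0 := by rw [h, sub_self]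
    rw [← this]; module)
  rw [this.2.1]
  exact mem_span_singleton.2 ⟨a, by simp⟩

theorem span1_le2 (x y : V) : span F {x} ≤ span F {x, y} := span_mono (by simp)

theorem tan_count (hc : CapSys F V ι v) (U : Submodule F V) (i : ι) :
    ∑ y : V, (if y ∈ U ∧ Tan F v i y then (1 : ℤ) else 0) =
     (∑ y : V, if y ∈ U then (1 : ℤ) else 0) - (∑ y : V, if y ∈ U ⊓ span F {v i} then (1 : ℤ) else 0)
      - ∑ j ∈ Finset.univ.erase i, ((∑ y : V, if y ∈ U ⊓ span F {v i, v j} then (1 : ℤ) else 0)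
          - (∑ y : V, if y ∈ U ⊓ span F {v i} then (1 : ℤ) else 0)) := by
  simp only [← Finset.sum_sub_distrib]
  rw [Finset.sum_comm, ← Finset.sum_sub_distrib]
  apply Finset.sum_congr rfl
  intro y _
  by_cases hU : y ∈ U
  · by_cases h1 : y ∈ span F {v i}
    · have : ∀ j, y ∈ span F {v i, v j} := fun j => span1_le2 _ _ h1
      simp [hU, h1, this, Tan]
    · by_cases h2 : ∃ j, j ≠ i ∧ y ∈ span F {v i, v j}
      · obtain ⟨j, hj, hyj⟩ := h2
        rw [Finset.sum_eq_single_of_mem j (Finset.mem_erase.2 ⟨hj, Finset.mem_univ _⟩)]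
        · have : ¬ Tan F v i y := fun h => h.2 j hj hyj
          simp [hU, h1, hyj, this]
        · intro l hl hlj
          have hl' := Finset.ne_of_mem_erase hl
          have : y ∉ span F {v i, v l} := fun h =>
            h1 (line_unique hc hj.symm hl'.symm hlj.symm hyj h)
          simp [h1, this]
      · have ht : Tan F v i y := ⟨h1, fun j hj h => h2 ⟨j, hj, h⟩⟩
        rw [Finset.sum_eq_zero]
        · simp [hU, h1, ht]
        · intro l hl
          have hl' := Finset.ne_of_mem_erase hl
          have : y ∉ span F {v i, v l} := ht.2 l hl'
          simp [h1, this]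
  · simp [hU]

theorem card_span1 (hc : CapSys F V ι v) (i : ι) :
    ∑ y : V, (if y ∈ span F {v i} then (1 : ℤ) else 0) = (Fintype.card F : ℤ) := by
  rw [card_sub, fr1 _ (hc.ne i), pow_one]

theorem card_span2 (hc : CapSys F V ι v) {i j : ι} (hij : i ≠ j) :
    ∑ y : V, (if y ∈ span F {v i, v j} then (1 : ℤ) else 0) = (Fintype.card F : ℤ) ^ 2 := by
  rw [card_sub, fr2 _ _ (hc.ind2 i j hij)]

theorem sum_erase_const (i : ι) (c : ℤ) : ∑ _j ∈ Finset.univ.erase i, c = ((Fintype.card ι : ℤ) - 1) * c := by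
  rw [Finset.sum_const, Finset.card_erase_of_mem (Finset.mem_univ _), Finset.card_univ, nsmul_eq_mul]
  have : 1 ≤ Fintype.card ι := Fintype.card_pos_iff.2 ⟨i⟩
  push_cast [this]; ring

/-- number of tangents at a point -/
theorem tan_total (hV : Module.finrank F V = 5) (hc : CapSys F V ι v) (i : ι) :
    ∑ y : V, (if Tan F v i y then (1 : ℤ) else 0) = ((Fintype.card F : ℤ) ^ 2 - (Fintype.card F : ℤ)) * ((Fintype.card F : ℤ) ^ 3 + (Fintype.card F : ℤ) ^ 2 + (Fintype.card F : ℤ) + 2 - (Fintype.card ι : ℤ)) := by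
  have h := tan_count hc ⊤ i
  simp only [mem_top, true_and, top_inf_eq] at h
  have h5 := card_sub (⊤ : Submodule F V)
  simp only [mem_top, finrank_top, hV] at h5
  rw [h, h5, card_span1 hc, Finset.sum_congr rfl (g := fun _ => (Fintype.card F : ℤ) ^ 2 - (Fintype.card F : ℤ)), sum_erase_const]
  · ring
  · intro j hj
    rw [card_span2 hc (Finset.ne_of_mem_erase hj).symm]

theorem fr_ker (hV : Module.finrank F V = 5) (f : Module.Dual F V) (hf : f ≠ 0) :
    Module.finrank F (LinearMap.ker f) = 4 := by
  have := Module.Dual.finrank_ker_add_one_of_ne_zero (f := f) hf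
  omega

theorem tan_ker_mem (hV : Module.finrank F V = 5) (hc : CapSys F V ι v) (f : Module.Dual F V) (hf : f ≠ 0)
    (i : ι) (hi : f (v i) = 0) :
    ∑ y : V, (if f y = 0 ∧ Tan F v i y then (1 : ℤ) else 0)
      = ((Fintype.card F : ℤ) ^ 2 - (Fintype.card F : ℤ)) * ((Fintype.card F : ℤ) ^ 2 + (Fintype.card F : ℤ) + 2 - ∑ l, (if f (v l) = 0 then 1 else 0)) := by
  have h := tan_count hc (LinearMap.ker f) i
  have e1 : LinearMap.ker f ⊓ span F {v i} = span F {v i} := by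
    rw [inf_eq_right, span_le]; simpa using hi
  have e2 : ∀ j ∈ Finset.univ.erase i,
      (∑ y : V, if y ∈ LinearMap.ker f ⊓ span F {v i, v j} then (1 : ℤ) else 0) - (Fintype.card F : ℤ) =
      (if f (v j) = 0 then 1 else 0) * ((Fintype.card F : ℤ) ^ 2 - (Fintype.card F : ℤ)) := by
    intro j hj
    have hij := (Finset.ne_of_mem_erase hj).symm
    split_ifs with hfj
    · have : LinearMap.ker f ⊓ span F {v i, v j} = span F {v i, v j} := by
        rw [inf_eq_right, span_le]
        rintro x (rfl | rfl)
        · simpa using hi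
        · simpa using hfj
      rw [this, card_span2 hc hij, one_mul]
    · have : LinearMap.ker f ⊓ span F {v i, v j} = span F {v i} := by
        apply le_antisymm
        · rintro x ⟨hx1, hx2⟩
          obtain ⟨a, b, rfl⟩ := mem_span_pair.1 hx2
          have hb : b = 0 := by simpa [hi, hfj] using hx1
          exact mem_span_singleton.2 ⟨a, by simp [hb]⟩
        · exact le_inf (by rw [← e1]; exact inf_le_left) (span1_le2 _ _)
      rw [this, card_span1 hc]; ring
  rw [e1, card_span1 hc, Finset.sum_congr rfl e2, card_sub, fr_ker hV f hf, ← Finset.sum_mul] at h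
  simp only [LinearMap.mem_ker] at h
  rw [h, ← Finset.add_sum_erase _ _ (Finset.mem_univ i), if_pos hi]
  ring

theorem tan_ker_notMem (hV : Module.finrank F V = 5) (hc : CapSys F V ι v) (f : Module.Dual F V) (hf : f ≠ 0)
    (i : ι) (hi : f (v i) ≠ 0) :
    ∑ y : V, (if f y = 0 ∧ Tan F v i y then (1 : ℤ) else 0)
      = ((Fintype.card F : ℤ) - 1) * ((Fintype.card F : ℤ) ^ 3 + (Fintype.card F : ℤ) ^ 2 + (Fintype.card F : ℤ) + 2 - (Fintype.card ι : ℤ)) := by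
  have h := tan_count hc (LinearMap.ker f) i
  have e1 : LinearMap.ker f ⊓ span F {v i} = ⊥ := by
    rw [eq_bot_iff]
    rintro x ⟨hx1, hx2⟩
    obtain ⟨a, rfl⟩ := mem_span_singleton.1 hx2
    have ha : a = 0 := by simpa [hi] using hx1
    simp [ha]
  have e2 : ∀ j ∈ Finset.univ.erase i,
      (∑ y : V, if y ∈ LinearMap.ker f ⊓ span F {v i, v j} then (1 : ℤ) else 0) - 1 = (Fintype.card F : ℤ) - 1 := by
    intro j hj
    have hij := (Finset.ne_of_mem_erase hj).symm
    have : LinearMap.ker f ⊓ span F {v i, v j} = span F {f (v j) • v i - f (v i) • v j} := by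
      apply le_antisymm
      · rintro x ⟨hx1, hx2⟩
        obtain ⟨a, b, rfl⟩ := mem_span_pair.1 hx2
        have hb : a * f (v i) + b * f (v j) = 0 := by simpa using hx1
        refine mem_span_singleton.2 ⟨- b / f (v i), ?_⟩
        have ha : a = - b / f (v i) * f (v j) := by field_simp; linear_combination hb
        rw [smul_sub, smul_smul, smul_smul, ← ha, div_mul_cancel₀ _ hi]; module
      · rw [span_le]
        rintro x rfl
        refine ⟨?_, ?_⟩
        · simp only [SetLike.mem_coe, LinearMap.mem_ker, map_sub, map_smul, smul_eq_mul]; ring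
        · exact mem_span_pair.2 ⟨f (v j), - f (v i), by module⟩
    rw [this, card_sub, fr1, pow_one]
    intro h0
    have := hc.ind2 i j hij (f (v j)) (- f (v i)) (by rw [← h0]; module)
    exact hi (by simpa using this.2)
  rw [e1] at h
  have e3 : (∑ y : V, if y ∈ (⊥ : Submodule F V) then (1 : ℤ) else 0) = 1 := by
    rw [card_sub]; simp
  rw [e3, Finset.sum_congr rfl e2, card_sub, fr_ker hV f hf, sum_erase_const] at h
  simp only [LinearMap.mem_ker] at h
  rw [h]
  ring

end cap

theorem det3_ne {F : Type*} [Field F] (x y z : Fin 3 → F)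
    (h : ∀ α β γ : F, α • x + β • y + γ • z = 0 → α = 0 ∧ β = 0 ∧ γ = 0) : det3 x y z ≠ 0 := by
  have e : det3 x y z = Matrix.det (Matrix.of ![x, y, z]) := by
    rw [Matrix.det_fin_three]; simp [det3]; ring
  rw [e]
  intro h0
  obtain ⟨u, hu, hu0⟩ := Matrix.exists_vecMul_eq_zero_iff.2 h0
  apply hu
  have := h (u 0) (u 1) (u 2) (by
    rw [← hu0]
    ext k
    simp [Matrix.vecMul, dotProduct, Fin.sum_univ_three])
  ext k; fin_cases k <;> simp [this]

section cap
open Submodule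
open scoped Classical
variable {F : Type*} [Field F] [Fintype F] {V : Type*} [AddCommGroup V] [Module F V] [Fintype V]
  {ι : Type*} [Fintype ι] {v : ι → V}

/-- number of further cap points in the plane spanned by `v i`, `v j`, `z` -/
noncomputable def MM (F : Type*) [Field F] {V : Type*} [AddCommGroup V] [Module F V]
    {ι : Type*} [Fintype ι] (v : ι → V) (i j : ι) (z : V) : ℤ :=
  ∑ l ∈ (Finset.univ.erase i).erase j, if v l ∈ span F {z, v i, v j} then 1 else 0

theorem notMem_line (hc : CapSys F V ι v) {i j l : ι} (hij : i ≠ j) (hil : i ≠ l) (hjl : j ≠ l) :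
    v l ∉ span F {v i, v j} := by
  intro h
  obtain ⟨a, b, h⟩ := mem_span_pair.1 h
  have := hc.ind i j l hij hil hjl a b (-1) (by rw [h]; module)
  simp at this

theorem plane_iff {x y z w : V} (hz : z ∉ span F {x, y}) (hw : w ∉ span F {x, y}) :
    w ∈ span F {z, x, y} ↔ z ∈ span F {w, x, y} :=
  ⟨fun h => mem_span_insert_exchange h hw, fun h => mem_span_insert_exchange h hz⟩

theorem line_le_plane (x y z : V) : span F {x, y} ≤ span F {z, x, y} := span_mono (by
  intro a ha; exact Set.mem_insert_of_mem _ ha)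

theorem plane_le {x y z w : V} (h : z ∈ span F {w, x, y}) : span F {z, x, y} ≤ span F {w, x, y} := by
  rw [span_le]
  intro a ha
  rcases ha with rfl | ha
  · exact h
  · exact line_le_plane _ _ _ (subset_span ha)

theorem plane_eq {x y z w : V} (hz : z ∉ span F {x, y}) (h : z ∈ span F {w, x, y}) :
    span F {z, x, y} = span F {w, x, y} := by
  apply le_antisymm (plane_le h)
  exact plane_le (mem_span_insert_exchange h hz)

theorem card_plane (hc : CapSys F V ι v) {i j l : ι} (hij : i ≠ j) (hil : i ≠ l) (hjl : j ≠ l) :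
    ∑ y : V, (if y ∈ span F {v l, v i, v j} then (1 : ℤ) else 0) = (Fintype.card F : ℤ) ^ 3 := by
  rw [card_sub, fr3 _ _ _ (hc.ind l i j hil.symm hjl.symm hij)]

theorem sum_plane1 (hc : CapSys F V ι v) {i j l : ι} (hij : i ≠ j) (hil : i ≠ l) (hjl : j ≠ l) :
    ∑ z : V, (if z ∉ span F {v i, v j} ∧ v l ∈ span F {z, v i, v j} then (1 : ℤ) else 0)
      = (Fintype.card F : ℤ) ^ 3 - (Fintype.card F : ℤ) ^ 2 := by
  rw [← card_plane hc hij hil hjl, ← card_span2 hc hij, ← Finset.sum_sub_distrib]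
  apply Finset.sum_congr rfl
  intro z _
  by_cases hz : z ∈ span F {v i, v j}
  · have := line_le_plane _ _ (v l) hz
    simp [hz, this]
  · simp only [hz, not_false_eq_true, true_and, plane_iff hz (notMem_line hc hij hil hjl), if_false, sub_zero]

theorem sum_plane2 (hc : CapSys F V ι v) {i j l : ι} (l' : ι) (hij : i ≠ j) (hil : i ≠ l) (hjl : j ≠ l) :
    ∑ z : V, (if z ∉ span F {v i, v j} ∧ v l ∈ span F {z, v i, v j} ∧ v l' ∈ span F {z, v i, v j}
        then (1 : ℤ) else 0)
      = ((Fintype.card F : ℤ) ^ 3 - (Fintype.card F : ℤ) ^ 2) * (if v l' ∈ span F {v l, v i, v j} then 1 else 0) := by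
  rw [← sum_plane1 hc hij hil hjl, Finset.sum_mul]
  apply Finset.sum_congr rfl
  intro z _
  by_cases hz : z ∈ span F {v i, v j}
  · simp [hz]
  · by_cases hl : v l ∈ span F {z, v i, v j}
    · have := plane_eq hz ((plane_iff hz (notMem_line hc hij hil hjl)).1 hl)
      have hl' : v l ∈ span F {v l, v i, v j} := subset_span (by simp)
      simp [hz, this, hl']
    · simp [hl]

theorem sum_erase2_const {i j : ι} (hij : i ≠ j) (c : ℤ) :
    ∑ _l ∈ (Finset.univ.erase i).erase j, c = ((Fintype.card ι : ℤ) - 2) * c := by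
  have hj : j ∈ Finset.univ.erase i := Finset.mem_erase.2 ⟨hij.symm, Finset.mem_univ _⟩
  have h1 := Finset.card_erase_add_one hj
  have h2 := Finset.card_erase_add_one (Finset.mem_univ i)
  rw [Finset.card_univ] at h2
  rw [Finset.sum_const, nsmul_eq_mul]
  congr 1
  omega

theorem mem_erase2 {i j l : ι} : l ∈ (Finset.univ.erase i).erase j ↔ i ≠ l ∧ j ≠ l := by
  simp only [Finset.mem_erase, Finset.mem_univ, and_true]; tauto

theorem sum_MM (hc : CapSys F V ι v) {i j : ι} (hij : i ≠ j) :
    ∑ z : V, (if z ∉ span F {v i, v j} then MM F v i j z else 0) = ((Fintype.card ι : ℤ) - 2) * ((Fintype.card F : ℤ) ^ 3 - (Fintype.card F : ℤ) ^ 2) := by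
  unfold MM
  rw [← sum_erase2_const hij, Finset.sum_congr rfl (g := fun z => ∑ l ∈ (Finset.univ.erase i).erase j,
    (if z ∉ span F {v i, v j} ∧ v l ∈ span F {z, v i, v j} then (1 : ℤ) else 0)), Finset.sum_comm]
  · apply Finset.sum_congr rfl
    intro l hl
    rw [mem_erase2] at hl
    exact sum_plane1 hc hij hl.1 hl.2
  · intro z _
    by_cases hz : z ∈ span F {v i, v j} <;> simp [hz]

/-- ordered pairs coplanar with `v i`, `v j` -/
noncomputable def C2 (F : Type*) [Field F] {V : Type*} [AddCommGroup V] [Module F V]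
    {ι : Type*} [Fintype ι] (v : ι → V) (i j : ι) : ℤ :=
  ∑ l ∈ (Finset.univ.erase i).erase j, ∑ l' ∈ (Finset.univ.erase i).erase j,
    if v l' ∈ span F {v l, v i, v j} then 1 else 0

theorem sum_MM_sq (hc : CapSys F V ι v) {i j : ι} (hij : i ≠ j) :
    ∑ z : V, (if z ∉ span F {v i, v j} then MM F v i j z ^ 2 else 0) = ((Fintype.card F : ℤ) ^ 3 - (Fintype.card F : ℤ) ^ 2) * C2 F v i j := by
  unfold MM C2
  rw [Finset.mul_sum, Finset.sum_congr rfl (g := fun z => ∑ l ∈ (Finset.univ.erase i).erase j,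
    ∑ l' ∈ (Finset.univ.erase i).erase j,
    (if z ∉ span F {v i, v j} ∧ v l ∈ span F {z, v i, v j} ∧ v l' ∈ span F {z, v i, v j}
      then (1 : ℤ) else 0)), Finset.sum_comm]
  · apply Finset.sum_congr rfl
    intro l hl
    rw [mem_erase2] at hl
    rw [Finset.sum_comm, Finset.mul_sum]
    apply Finset.sum_congr rfl
    intro l' _
    exact sum_plane2 hc l' hij hl.1 hl.2
  · intro z _
    by_cases hz : z ∈ span F {v i, v j}
    · simp [hz]
    · rw [if_pos hz, sq, Finset.sum_mul_sum]
      apply Finset.sum_congr rfl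
      intro l _
      apply Finset.sum_congr rfl
      intro l' _
      by_cases h1 : v l ∈ span F {z, v i, v j} <;> by_cases h2 : v l' ∈ span F {z, v i, v j} <;>
        simp [hz, h1, h2]

theorem sum_one_off (hV : Module.finrank F V = 5) (hc : CapSys F V ι v) {i j : ι} (hij : i ≠ j) :
    ∑ z : V, (if z ∉ span F {v i, v j} then (1 : ℤ) else 0) = (Fintype.card F : ℤ) ^ 5 - (Fintype.card F : ℤ) ^ 2 := by
  have h5 := card_sub (⊤ : Submodule F V)
  simp only [mem_top, finrank_top, hV] at h5
  rw [← card_span2 hc hij, ← h5, ← Finset.sum_sub_distrib]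
  apply Finset.sum_congr rfl
  intro z _
  by_cases hz : z ∈ span F {v i, v j} <;> simp [hz]

/-- transfer of the key lemma -/
theorem tan_plane_le [CharP F 2] (hc : CapSys F V ι v) {i j : ι} (hij : i ≠ j) {y z : V}
    (hz : z ∉ span F {v i, v j}) (hy : y ∈ span F {v i, v j}) :
    ∑ l, (if Tan F v l y ∧ v l ∈ span F {z, v i, v j} then (1 : ℤ) else 0) ≤ (Fintype.card F : ℤ) - MM F v i j z := by
  have hzind : ∀ α β γ : F, α • z + β • v i + γ • v j = 0 → α = 0 ∧ β = 0 ∧ γ = 0 := by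
    intro α β γ h
    have hα : α = 0 := by
      by_contra hα
      apply hz
      refine mem_span_pair.2 ⟨- (α⁻¹ * β), - (α⁻¹ * γ), ?_⟩
      have : α⁻¹ • (α • z + β • v i + γ • v j) = 0 := by rw [h, smul_zero]
      rw [smul_add, smul_add, smul_smul, smul_smul, smul_smul, inv_mul_cancel₀ hα, one_smul] at this
      rw [← sub_eq_zero, ← neg_eq_zero, ← this]; module
    rw [hα] at h
    exact ⟨hα, hc.ind2 i j hij β γ (by rw [← h]; module)⟩
  let L : (Fin 3 → F) →ₗ[F] V :=
    { toFun := fun x => x 0 • z + x 1 • v i + x 2 • v j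
      map_add' := by intro x y; simp only [Pi.add_apply]; module
      map_smul' := by intro c x; simp only [Pi.smul_apply, smul_eq_mul, RingHom.id_apply]; module }
  have hL : ∀ x, L x = x 0 • z + x 1 • v i + x 2 • v j := fun _ => rfl
  have hex : ∀ l, ∃ x, v l ∈ span F {z, v i, v j} → L x = v l := by
    intro l
    by_cases h : v l ∈ span F {z, v i, v j}
    · obtain ⟨a, b, c, h⟩ := mem_span_triple.1 h
      exact ⟨![a, b, c], fun _ => by rw [hL, ← h]; simp⟩
    · exact ⟨0, fun h' => absurd h' h⟩
  choose c hcL using hex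
  obtain ⟨β, γ, hyβ⟩ := mem_span_pair.1 hy
  set yc : Fin 3 → F := ![0, β, γ] with hyc
  have hLy : L yc = y := by rw [hL, ← hyβ]; simp [hyc]
  set J := Finset.univ.filter (fun l => v l ∈ span F {z, v i, v j}) with hJ
  have hJm : ∀ l ∈ J, L (c l) = v l := fun l hl => hcL l (by simpa [hJ] using hl)
  have hvinj : ∀ l l', v l = v l' → l = l' := by
    intro l l' h
    by_contra hne
    have := hc.ind2 l l' hne 1 (-1) (by rw [h]; module)
    simp at this
  have hcinj : ∀ l ∈ J, ∀ l' ∈ J, c l = c l' → l = l' := by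
    intro l hl l' hl' h
    apply hvinj
    rw [← hJm l hl, ← hJm l' hl', h]
  have hiJ : i ∈ J := by
    simp only [hJ, Finset.mem_filter, Finset.mem_univ, true_and]; exact subset_span (by simp)
  have hjJ : j ∈ J := by
    simp only [hJ, Finset.mem_filter, Finset.mem_univ, true_and]; exact subset_span (by simp)
  have hJcard : (J.card : ℤ) = MM F v i j z + 2 := by
    have h1 : (J.card : ℤ) = ∑ l, if v l ∈ span F {z, v i, v j} then (1 : ℤ) else 0 := by
      rw [Finset.sum_boole]
    have hj : j ∈ Finset.univ.erase i := Finset.mem_erase.2 ⟨hij.symm, Finset.mem_univ _⟩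
    rw [h1, ← Finset.add_sum_erase _ _ (Finset.mem_univ i), ← Finset.add_sum_erase _ _ hj,
      if_pos (by simpa [hJ] using hiJ), if_pos (by simpa [hJ] using hjJ)]
    unfold MM; ring
  set J' := Finset.univ.filter (fun l => Tan F v l y ∧ v l ∈ span F {z, v i, v j}) with hJ'
  have hJJ : J' ⊆ J := by
    intro l hl
    simp only [hJ, hJ', Finset.mem_filter, Finset.mem_univ, true_and] at hl ⊢
    exact hl.2
  rw [Finset.sum_boole, ← hJ']
  set A := J.image c with hA
  have hAcard : A.card = J.card := Finset.card_image_of_injOn (fun l hl l' hl' h => hcinj l hl l' hl' h)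
  have hq2 : 2 ≤ Fintype.card F := Fintype.one_lt_card
  by_cases h3 : 3 ≤ A.card
  · have hle : J'.card ≤ (A.filter (fun a => ∀ e ∈ A, e ≠ a → det3 a e yc ≠ 0)).card := by
      apply Finset.card_le_card_of_injOn c
      · intro l hl
        have hlJ := hJJ hl
        simp only [Finset.coe_filter, Set.mem_ofPred_eq]
        refine ⟨Finset.mem_image_of_mem _ hlJ, ?_⟩
        intro e he hne
        obtain ⟨l', hl', rfl⟩ := Finset.mem_image.1 he
        have hll : l' ≠ l := fun h => hne (by rw [h])
        have hT : Tan F v l y := by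
          have : l ∈ J' := hl
          simp only [hJ', Finset.mem_filter, Finset.mem_univ, true_and] at this
          exact this.1
        apply det3_ne
        intro a b g h0
        have h1 := congrArg L h0
        rw [map_add, map_add, map_smul, map_smul, map_smul, hLy, hJm l hlJ, hJm l' hl', map_zero] at h1
        have hg : g = 0 := by
          by_contra hg
          apply hT.2 l' hll
          refine mem_span_pair.2 ⟨- (g⁻¹ * a), - (g⁻¹ * b), ?_⟩
          have : g⁻¹ • (a • v l + b • v l' + g • y) = 0 := by rw [h1, smul_zero]
          rw [smul_add, smul_add, smul_smul, smul_smul, smul_smul, inv_mul_cancel₀ hg, one_smul] at this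
          rw [← sub_eq_zero, ← neg_eq_zero, ← this]; module
        rw [hg] at h1
        have := hc.ind2 l l' hll.symm a b (by rw [← h1]; module)
        exact ⟨this.1, this.2, hg⟩
      · intro l hl l' hl' h
        exact hcinj l (hJJ hl) l' (hJJ hl') h
    have hmain := tangents_le A ?_ h3 yc (c i) (c j) (Finset.mem_image_of_mem _ hiJ)
      (Finset.mem_image_of_mem _ hjJ) (fun h => hij (hcinj i hiJ j hjJ h)) ?_
    · omega
    · intro x hx y' hy' w hw hxy hxw hyw
      obtain ⟨a, ha, rfl⟩ := Finset.mem_image.1 hx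
      obtain ⟨b, hb, rfl⟩ := Finset.mem_image.1 hy'
      obtain ⟨d, hd, rfl⟩ := Finset.mem_image.1 hw
      apply det3_ne
      intro α β γ h0
      have h1 := congrArg L h0
      rw [map_add, map_add, map_smul, map_smul, map_smul, hJm a ha, hJm b hb, hJm d hd, map_zero] at h1
      exact hc.ind a b d (fun h => hxy (by rw [h])) (fun h => hxw (by rw [h])) (fun h => hyw (by rw [h])) _ _ _ h1
    · have hLinj : Function.Injective L := by
        rw [← LinearMap.ker_eq_bot, LinearMap.ker_eq_bot']
        intro x hx
        have := hzind _ _ _ hx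
        ext k; fin_cases k <;> simp [this]
      have hyc2 : yc = β • c i + γ • c j := by
        apply hLinj
        rw [hLy, map_add, map_smul, map_smul, hJm i hiJ, hJm j hjJ, hyβ]
      rw [hyc2]
      unfold det3
      simp only [Pi.add_apply, Pi.smul_apply, smul_eq_mul]; ring
  · have := Finset.card_le_card hJJ
    have : 2 ≤ J.card := Finset.one_lt_card.2 ⟨i, hiJ, j, hjJ, hij⟩
    omega

/-- every point is on at most `t` tangents -/
theorem n_le (hV : Module.finrank F V = 5) [CharP F 2] (hc : CapSys F V ι v) (y : V) (i₀ : ι) :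
    ∑ l, (if Tan F v l y then (1 : ℤ) else 0) ≤ (Fintype.card F : ℤ) ^ 3 + (Fintype.card F : ℤ) ^ 2 + (Fintype.card F : ℤ) + 2 - (Fintype.card ι : ℤ) := by
  have hq2 : 2 ≤ (Fintype.card F : ℤ) := by exact_mod_cast (Fintype.one_lt_card : 1 < Fintype.card F)
  rcases hc.compl y with ⟨i, hi⟩ | ⟨i, j, hij, hy⟩
  · have : ∀ l, ¬ Tan F v l y := by
      intro l h
      by_cases hl : i = l
      · subst hl; exact h.1 hi
      · exact h.2 i hl (by rw [Set.pair_comm]; exact span1_le2 _ _ hi)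
    simp only [this, if_false, Finset.sum_const_zero]
    have h1 := tan_total hV hc i₀
    have h2 : 0 ≤ ∑ y : V, (if Tan F v i₀ y then (1 : ℤ) else 0) :=
      Finset.sum_nonneg fun y _ => by split_ifs <;> norm_num
    rw [h1] at h2
    exact nonneg_of_mul_nonneg_right h2 (by nlinarith)
  · have hTne : ∀ l, Tan F v l y → i ≠ l ∧ j ≠ l := by
      intro l h
      constructor
      · rintro rfl; exact h.2 j hij.symm hy
      · rintro rfl; exact h.2 i hij (by rw [Set.pair_comm]; exact hy)
    have h1 : (∑ l, (if Tan F v l y then (1 : ℤ) else 0)) * ((Fintype.card F : ℤ) ^ 3 - (Fintype.card F : ℤ) ^ 2) =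
        ∑ z : V, if z ∉ span F {v i, v j} then
          ∑ l, (if Tan F v l y ∧ v l ∈ span F {z, v i, v j} then (1 : ℤ) else 0) else 0 := by
      rw [Finset.sum_mul, Finset.sum_congr rfl (s₁ := (Finset.univ : Finset V))
        (g := fun z => ∑ l, (if Tan F v l y then (1 : ℤ) else 0) *
          (if z ∉ span F {v i, v j} ∧ v l ∈ span F {z, v i, v j} then (1 : ℤ) else 0)), Finset.sum_comm]
      · apply Finset.sum_congr rfl
        intro l _
        rw [← Finset.mul_sum]
        by_cases hT : Tan F v l y
        · rw [sum_plane1 hc hij (hTne l hT).1 (hTne l hT).2]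
        · simp [hT]
      · intro z _
        by_cases hz : z ∈ span F {v i, v j}
        · simp [hz]
        · rw [if_pos hz]
          apply Finset.sum_congr rfl
          intro l _
          by_cases hT : Tan F v l y <;> simp [hz, hT]
    have h2 : (∑ l, (if Tan F v l y then (1 : ℤ) else 0)) * ((Fintype.card F : ℤ) ^ 3 - (Fintype.card F : ℤ) ^ 2) ≤
        ∑ z : V, ((Fintype.card F : ℤ) * (if z ∉ span F {v i, v j} then (1 : ℤ) else 0) -
          (if z ∉ span F {v i, v j} then MM F v i j z else 0)) := by
      rw [h1]
      apply Finset.sum_le_sum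
      intro z _
      by_cases hz : z ∈ span F {v i, v j}
      · simp [hz]
      · simp only [hz, not_false_eq_true, if_true, mul_one]
        exact tan_plane_le hc hij hz hy
    rw [Finset.sum_sub_distrib, ← Finset.mul_sum, sum_one_off hV hc hij, sum_MM hc hij] at h2
    have h3 : 0 < (Fintype.card F : ℤ) ^ 3 - (Fintype.card F : ℤ) ^ 2 := by nlinarith [pow_pos (show 0 < (Fintype.card F : ℤ) by linarith) 2]
    have h4 : (∑ l, (if Tan F v l y then (1 : ℤ) else 0)) * ((Fintype.card F : ℤ) ^ 3 - (Fintype.card F : ℤ) ^ 2) ≤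
        ((Fintype.card F : ℤ) ^ 3 + (Fintype.card F : ℤ) ^ 2 + (Fintype.card F : ℤ) + 2 - (Fintype.card ι : ℤ)) * ((Fintype.card F : ℤ) ^ 3 - (Fintype.card F : ℤ) ^ 2) := by
      refine h2.trans (le_of_eq ?_); ring
    exact le_of_mul_le_mul_right h4 h3

end cap

section cap
open Submodule
open scoped Classical
variable {F : Type*} [Field F] [Fintype F] {V : Type*} [AddCommGroup V] [Module F V] [Fintype V]
  {ι : Type*} [Fintype ι] {v : ι → V}

/-- scalars giving a secant through `v i` -/
noncomputable def Bad (F : Type*) [Field F] [Fintype F] {V : Type*} [AddCommGroup V] [Module F V]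
    {ι : Type*} (v : ι → V) (i j : ι) (z : V) : Finset F :=
  Finset.univ.filter (fun β => ∃ l, (i ≠ l ∧ j ≠ l) ∧ z + β • v j ∈ span F {v i, v l})

theorem tan_of_notBad {i j : ι} {z : V}
    (hz : z ∉ span F {v i, v j}) (α β : F) (hβ : β ∉ Bad F v i j z) :
    Tan F v i (z + α • v i + β • v j) := by
  have hvi : v i ∈ span F {v i, v j} := subset_span (by simp)
  have hvj : v j ∈ span F {v i, v j} := subset_span (by simp)
  have key : z + α • v i + β • v j ∉ span F {v i, v j} := by
    intro h
    apply hz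
    have := sub_mem (sub_mem h (smul_mem _ β hvj)) (smul_mem _ α hvi)
    convert this using 1; module
  refine ⟨fun h => key (span1_le2 _ _ h), ?_⟩
  intro l hl h
  by_cases hlj : j = l
  · subst hlj; exact key h
  · apply hβ
    simp only [Bad, Finset.mem_filter, Finset.mem_univ, true_and]
    refine ⟨l, ⟨hl.symm, hlj⟩, ?_⟩
    have hvi' : v i ∈ span F {v i, v l} := subset_span (by simp)
    have := sub_mem h (smul_mem _ α hvi')
    convert this using 1; module

theorem Bad_card (hc : CapSys F V ι v) {i j : ι} (hij : i ≠ j) {z : V}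
    (hz : z ∉ span F {v i, v j}) : ((Bad F v i j z).card : ℤ) ≤ MM F v i j z := by
  have hvi : v i ∈ span F {v i, v j} := subset_span (by simp)
  have hvj : v j ∈ span F {v i, v j} := subset_span (by simp)
  have hex : ∀ β, ∃ l, β ∈ Bad F v i j z → (i ≠ l ∧ j ≠ l) ∧ z + β • v j ∈ span F {v i, v l} := by
    intro β
    by_cases h : β ∈ Bad F v i j z
    · have h' := h
      simp only [Bad, Finset.mem_filter, Finset.mem_univ, true_and] at h'
      obtain ⟨l, hl⟩ := h'
      exact ⟨l, fun _ => hl⟩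
    · exact ⟨i, fun h' => absurd h' h⟩
  choose l hl using hex
  unfold MM
  rw [Finset.sum_boole]
  have := Finset.card_le_card_of_injOn (s := Bad F v i j z)
    (t := ((Finset.univ.erase i).erase j).filter (fun l => v l ∈ span F {z, v i, v j})) l ?_ ?_
  · exact_mod_cast this
  · intro β hβ
    obtain ⟨h1, h2⟩ := hl β hβ
    simp only [Finset.coe_filter, Set.mem_ofPred_eq]
    refine ⟨mem_erase2.2 h1, ?_⟩
    obtain ⟨a, b, hab⟩ := mem_span_pair.1 h2
    have hb : b ≠ 0 := by
      rintro rfl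
      apply hz
      have e : z = a • v i - β • v j := by rw [eq_sub_iff_add_eq, ← hab]; module
      rw [e]
      exact sub_mem (smul_mem _ _ hvi) (smul_mem _ _ hvj)
    have e : v (l β) = b⁻¹ • (z + β • v j - a • v i) := by
      rw [← hab, add_sub_cancel_left, smul_smul, inv_mul_cancel₀ hb, one_smul]
    rw [e]
    apply smul_mem
    apply sub_mem (add_mem (subset_span (by simp)) (smul_mem _ _ (subset_span (by simp))))
      (smul_mem _ _ (subset_span (by simp)))
  · intro β hβ β' hβ' hll
    obtain ⟨h1, h2⟩ := hl β hβ
    obtain ⟨_, h2'⟩ := hl β' hβ'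
    rw [← hll] at h2'
    have h3 := sub_mem h2 h2'
    obtain ⟨a, b, hab⟩ := mem_span_pair.1 h3
    have := hc.ind i j (l β) hij h1.1 h1.2 (-a) (β - β') (-b) (by
      have h4 : (z + β • v j - (z + β' • v j)) - (a • v i + b • v (l β)) = 0 := by rw [hab, sub_self]
      rw [← h4]; module)
    exact sub_eq_zero.1 this.2.1

theorem MM_symm (i j : ι) (z : V) : MM F v j i z = MM F v i j z := by
  unfold MM
  rw [Finset.erase_right_comm, Set.pair_comm (v j)]

theorem MM_le [CharP F 2] (hc : CapSys F V ι v) {i j : ι} (hij : i ≠ j) {z : V}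
    (hz : z ∉ span F {v i, v j}) : 0 ≤ (Fintype.card F : ℤ) - MM F v i j z := by
  refine le_trans ?_ (tan_plane_le hc hij hz (zero_mem _))
  exact Finset.sum_nonneg fun y _ => by split_ifs <;> norm_num

theorem pair_lower [CharP F 2] (hc : CapSys F V ι v) {i j : ι} (hij : i ≠ j) :
    ∑ z : V, (if z ∉ span F {v i, v j} then ((Fintype.card F : ℤ) - MM F v i j z) ^ 2 else 0)
      ≤ (Fintype.card F : ℤ) ^ 2 * ∑ y : V, (if Tan F v i y ∧ Tan F v j y then (1 : ℤ) else 0) := by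
  have h1 : (Fintype.card F : ℤ) ^ 2 * ∑ y : V, (if Tan F v i y ∧ Tan F v j y then (1 : ℤ) else 0) =
      ∑ z : V, ∑ α : F, ∑ β : F, (if Tan F v i (z + α • v i + β • v j) ∧ Tan F v j (z + α • v i + β • v j)
        then (1 : ℤ) else 0) := by
    have h2 : ∀ α β : F, ∑ z : V, (if Tan F v i (z + α • v i + β • v j) ∧
        Tan F v j (z + α • v i + β • v j) then (1 : ℤ) else 0) =
        ∑ y : V, (if Tan F v i y ∧ Tan F v j y then (1 : ℤ) else 0) := by
      intro α β
      rw [← Equiv.sum_comp (Equiv.addRight (α • v i + β • v j))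
        (fun y => if Tan F v i y ∧ Tan F v j y then (1 : ℤ) else 0)]
      simp only [Equiv.coe_addRight, add_assoc]
      rfl
    rw [Finset.sum_comm, Finset.sum_congr rfl (fun α _ => Finset.sum_comm)]
    simp only [h2, Finset.sum_const, Finset.card_univ, nsmul_eq_mul]
    ring
  rw [h1]
  apply Finset.sum_le_sum
  intro z _
  by_cases hz : z ∈ span F {v i, v j}
  · simp only [hz, not_true_eq_false, if_false]
    exact Finset.sum_nonneg fun _ _ => Finset.sum_nonneg fun _ _ => by split_ifs <;> norm_num
  rw [if_pos hz]
  have hz' : z ∉ span F {v j, v i} := by rwa [Set.pair_comm]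
  have hd := MM_le hc hij hz
  have b1 := Bad_card hc hij hz
  have b2 := Bad_card hc hij.symm hz'
  rw [MM_symm] at b2
  have cnt : ∀ B : Finset F, ∑ β : F, (if β ∉ B then (1 : ℤ) else 0) = (Fintype.card F : ℤ) - B.card := by
    intro B
    rw [Finset.sum_boole, Finset.filter_not, Finset.filter_mem_eq_inter, Finset.univ_inter,
      Finset.cast_card_sdiff (Finset.subset_univ _), Finset.card_univ]
  calc ((Fintype.card F : ℤ) - MM F v i j z) ^ 2 ≤ ((Fintype.card F : ℤ) - (Bad F v j i z).card) * ((Fintype.card F : ℤ) - (Bad F v i j z).card) := by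
        rw [sq]; exact mul_le_mul (by linarith) (by linarith) hd (by linarith)
    _ = ∑ α : F, ∑ β : F, (if α ∉ Bad F v j i z then (1 : ℤ) else 0) * (if β ∉ Bad F v i j z then (1 : ℤ) else 0) := by
        rw [← cnt, ← cnt, Finset.sum_mul_sum]
    _ ≤ _ := by
        apply Finset.sum_le_sum; intro α _
        apply Finset.sum_le_sum; intro β _
        by_cases hα : α ∈ Bad F v j i z
        · simp only [hα, not_true_eq_false, if_false, zero_mul]; split_ifs <;> norm_num
        by_cases hβ : β ∈ Bad F v i j z
        · simp only [hβ, not_true_eq_false, if_false, mul_zero]; split_ifs <;> norm_num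
        have t1 := tan_of_notBad hz α β hβ
        have t2 := tan_of_notBad hz' β α hα
        have e : z + β • v j + α • v i = z + α • v i + β • v j := by abel
        rw [e] at t2
        simp [hα, hβ, t1, t2]

/-- `∑_y n_y (n_y - 1) ≤ (t-1) ∑ n_y` -/
theorem pair_upper (hV : Module.finrank F V = 5) [CharP F 2] (hc : CapSys F V ι v) :
    ∑ i, ∑ j ∈ Finset.univ.erase i, ∑ y : V, (if Tan F v i y ∧ Tan F v j y then (1 : ℤ) else 0)
      ≤ ((Fintype.card F : ℤ) ^ 3 + (Fintype.card F : ℤ) ^ 2 + (Fintype.card F : ℤ) + 2 - (Fintype.card ι : ℤ) - 1) * ((Fintype.card ι : ℤ) * (((Fintype.card F : ℤ) ^ 2 - (Fintype.card F : ℤ)) * ((Fintype.card F : ℤ) ^ 3 + (Fintype.card F : ℤ) ^ 2 + (Fintype.card F : ℤ) + 2 - (Fintype.card ι : ℤ)))) := by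
  have e1 : ∀ i, ∑ j ∈ Finset.univ.erase i, ∑ y : V, (if Tan F v i y ∧ Tan F v j y then (1 : ℤ) else 0) =
      ∑ y : V, (if Tan F v i y then (1 : ℤ) else 0) * ((∑ j, if Tan F v j y then (1 : ℤ) else 0) - 1) := by
    intro i
    rw [Finset.sum_comm]
    apply Finset.sum_congr rfl
    intro y _
    rw [← Finset.add_sum_erase _ _ (Finset.mem_univ i)]
    by_cases h : Tan F v i y <;> simp [h]
  calc _ = ∑ i, ∑ y : V, (if Tan F v i y then (1 : ℤ) else 0) *
        ((∑ j, if Tan F v j y then (1 : ℤ) else 0) - 1) := Finset.sum_congr rfl fun i _ => e1 i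
    _ ≤ ∑ i, ∑ y : V, (if Tan F v i y then (1 : ℤ) else 0) * ((Fintype.card F : ℤ) ^ 3 + (Fintype.card F : ℤ) ^ 2 + (Fintype.card F : ℤ) + 2 - (Fintype.card ι : ℤ) - 1) := by
        apply Finset.sum_le_sum; intro i _
        apply Finset.sum_le_sum; intro y _
        apply mul_le_mul_of_nonneg_left
        · linarith [n_le hV hc y i]
        · split_ifs <;> norm_num
    _ = _ := by
        simp only [← Finset.sum_mul, tan_total hV hc]
        rw [Finset.sum_const, Finset.card_univ, nsmul_eq_mul]
        ring

theorem D2_le (hV : Module.finrank F V = 5) [CharP F 2] (hc : CapSys F V ι v) :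
    ∑ i, ∑ j ∈ Finset.univ.erase i, ∑ z : V, (if z ∉ span F {v i, v j} then ((Fintype.card F : ℤ) - MM F v i j z) ^ 2 else 0)
      ≤ (Fintype.card F : ℤ) ^ 2 * (((Fintype.card F : ℤ) ^ 3 + (Fintype.card F : ℤ) ^ 2 + (Fintype.card F : ℤ) + 2 - (Fintype.card ι : ℤ) - 1) *
        ((Fintype.card ι : ℤ) * (((Fintype.card F : ℤ) ^ 2 - (Fintype.card F : ℤ)) * ((Fintype.card F : ℤ) ^ 3 + (Fintype.card F : ℤ) ^ 2 + (Fintype.card F : ℤ) + 2 - (Fintype.card ι : ℤ))))) := by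
  refine le_trans ?_ (mul_le_mul_of_nonneg_left (pair_upper hV hc) (by positivity))
  rw [Finset.mul_sum]
  apply Finset.sum_le_sum; intro i _
  rw [Finset.mul_sum]
  apply Finset.sum_le_sum; intro j hj
  exact pair_lower hc (Finset.ne_of_mem_erase hj).symm

theorem D2_eq (hV : Module.finrank F V = 5) (hc : CapSys F V ι v) {i j : ι} (hij : i ≠ j) :
    ∑ z : V, (if z ∉ span F {v i, v j} then ((Fintype.card F : ℤ) - MM F v i j z) ^ 2 else 0) =
      (Fintype.card F : ℤ) ^ 2 * ((Fintype.card F : ℤ) ^ 5 - (Fintype.card F : ℤ) ^ 2) - 2 * (Fintype.card F : ℤ) * (((Fintype.card ι : ℤ) - 2) * ((Fintype.card F : ℤ) ^ 3 - (Fintype.card F : ℤ) ^ 2)) + ((Fintype.card F : ℤ) ^ 3 - (Fintype.card F : ℤ) ^ 2) * C2 F v i j := by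
  rw [← sum_one_off hV hc hij, ← sum_MM hc hij, ← sum_MM_sq hc hij, Finset.mul_sum, Finset.mul_sum,
    ← Finset.sum_sub_distrib, ← Finset.sum_add_distrib]
  apply Finset.sum_congr rfl
  intro z _
  split_ifs <;> ring

/-- step one inequality -/
theorem window (hV : Module.finrank F V = 5) [CharP F 2] (hc : CapSys F V ι v) (i₀ : ι) (c : ℤ) :
    ((Fintype.card ι : ℤ) - 1) * ((2 * c + 1) * ((Fintype.card F : ℤ) ^ 3 + (Fintype.card F : ℤ) ^ 2 + (Fintype.card F : ℤ) + 2 - (Fintype.card ι : ℤ)) - c * (c + 1) * ((Fintype.card F : ℤ) ^ 2 + (Fintype.card F : ℤ) + 1)) ≤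
      (Fintype.card F : ℤ) * (((Fintype.card F : ℤ) ^ 3 + (Fintype.card F : ℤ) ^ 2 + (Fintype.card F : ℤ) + 2 - (Fintype.card ι : ℤ)) * ((Fintype.card F : ℤ) ^ 3 + (Fintype.card F : ℤ) ^ 2 + (Fintype.card F : ℤ) + 2 - (Fintype.card ι : ℤ) - 1)) := by
  have hq2 : 2 ≤ (Fintype.card F : ℤ) := by exact_mod_cast (Fintype.one_lt_card : 1 < Fintype.card F)
  have hk : 0 < (Fintype.card ι : ℤ) := by exact_mod_cast Fintype.card_pos_iff.2 ⟨i₀⟩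
  have hpair : ∀ i, ∀ j ∈ Finset.univ.erase i,
      ((Fintype.card F : ℤ) ^ 3 - (Fintype.card F : ℤ) ^ 2) * ((2 * c + 1) * ((Fintype.card F : ℤ) ^ 3 + (Fintype.card F : ℤ) ^ 2 + (Fintype.card F : ℤ) + 2 - (Fintype.card ι : ℤ)) - c * (c + 1) * ((Fintype.card F : ℤ) ^ 2 + (Fintype.card F : ℤ) + 1)) ≤
      ∑ z : V, (if z ∉ span F {v i, v j} then ((Fintype.card F : ℤ) - MM F v i j z) ^ 2 else 0) := by
    intro i j hj
    have hij := (Finset.ne_of_mem_erase hj).symm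
    have h0 : 0 ≤ ∑ z : V, (if z ∉ span F {v i, v j} then
        ((Fintype.card F : ℤ) - MM F v i j z - c) * ((Fintype.card F : ℤ) - MM F v i j z - c - 1) else 0) := by
      apply Finset.sum_nonneg
      intro z _
      split_ifs
      · rfl
      · generalize (Fintype.card F : ℤ) - MM F v i j z - c = x
        rcases le_or_gt x 0 with h | h
        · nlinarith
        · have : 0 ≤ x - 1 := by omega
          exact mul_nonneg h.le this
    have h1 : ∑ z : V, (if z ∉ span F {v i, v j} then
        ((Fintype.card F : ℤ) - MM F v i j z - c) * ((Fintype.card F : ℤ) - MM F v i j z - c - 1) else 0) =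
        ∑ z : V, (if z ∉ span F {v i, v j} then ((Fintype.card F : ℤ) - MM F v i j z) ^ 2 else 0)
        + ((c * (c + 1) - (2 * c + 1) * (Fintype.card F : ℤ)) * ∑ z : V, (if z ∉ span F {v i, v j} then (1 : ℤ) else 0)
        + (2 * c + 1) * ∑ z : V, (if z ∉ span F {v i, v j} then MM F v i j z else 0)) := by
      rw [Finset.mul_sum, Finset.mul_sum, ← Finset.sum_add_distrib, ← Finset.sum_add_distrib]
      apply Finset.sum_congr rfl
      intro z _
      split_ifs <;> ring
    rw [sum_one_off hV hc hij, sum_MM hc hij] at h1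
    rw [h1] at h0
    linarith
  have h2 := Finset.sum_le_sum (s := (Finset.univ : Finset ι)) fun i _ => Finset.sum_le_sum (hpair i)
  simp only [sum_erase_const] at h2
  rw [Finset.sum_const, Finset.card_univ, nsmul_eq_mul] at h2
  have h3 := h2.trans (D2_le hV hc)
  have hpos : 0 < (Fintype.card ι : ℤ) * ((Fintype.card F : ℤ) ^ 3 - (Fintype.card F : ℤ) ^ 2) := mul_pos hk (by nlinarith [pow_pos (show 0 < (Fintype.card F : ℤ) by linarith) 2])
  refine le_of_mul_le_mul_left ?_ hpos
  linarith

end cap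

section cap
open Submodule
open scoped Classical
variable {F : Type*} [Field F] [Fintype F] {V : Type*} [AddCommGroup V] [Module F V] [Fintype V]
  {ι : Type*} [Fintype ι] {v : ι → V} [Fintype (Module.Dual F V)]

/-- `f` vanishes on `s` -/
def Kills {F : Type*} [Field F] {V : Type*} [AddCommGroup V] [Module F V] (f : Module.Dual F V)
    (s : Set V) : Prop := ∀ x ∈ s, f x = 0

theorem dual_count (hV : Module.finrank F V = 5) (s : Set V) (r : ℕ)
    (hr : Module.finrank F (span F s) + r = 5) :
    ∑ f : Module.Dual F V, (if Kills f s then (1 : ℤ) else 0) = (Fintype.card F : ℤ) ^ r := by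
  have h1 := card_sub ((span F s).dualAnnihilator)
  have h2 := Subspace.finrank_add_finrank_dualAnnihilator_eq (span F s)
  have h3 : Module.finrank F (span F s).dualAnnihilator = r := by omega
  rw [h3] at h1
  rw [← h1]
  apply Finset.sum_congr rfl
  intro f _
  have : Kills f s ↔ f ∈ (span F s).dualAnnihilator := by
    rw [mem_dualAnnihilator]
    constructor
    · intro h
      have : span F s ≤ LinearMap.ker f := span_le.2 fun x hx => by simpa using h x hx
      intro w hw; exact this hw
    · intro h x hx; exact h x (subset_span hx)
  simp only [this]

theorem fr4 (w x y z : V) (h : ∀ α β γ : F, α • x + β • y + γ • z = 0 → α = 0 ∧ β = 0 ∧ γ = 0)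
    (hw : w ∉ span F {x, y, z}) : Module.finrank F (span F {w, x, y, z}) = 4 := by
  have hl : LinearIndependent F ![w, x, y, z] := by
    rw [Fintype.linearIndependent_iff]
    intro g hg
    rw [Fin.sum_univ_four] at hg
    simp only [Matrix.cons_val_zero, Matrix.cons_val_one, Matrix.cons_val] at hg
    have h0 : g 0 = 0 := by
      by_contra h0
      apply hw
      have e : w = (-(g 0)⁻¹) • (g 1 • x + g 2 • y + g 3 • z) := by
        have : g 1 • x + g 2 • y + g 3 • z = - (g 0 • w) := by
          rw [eq_neg_iff_add_eq_zero, ← hg]; module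
        rw [this, smul_neg, neg_smul, neg_neg, smul_smul, inv_mul_cancel₀ h0, one_smul]
      rw [e]
      exact smul_mem _ _ (add_mem (add_mem (smul_mem _ _ (subset_span (by simp)))
        (smul_mem _ _ (subset_span (by simp)))) (smul_mem _ _ (subset_span (by simp))))
    rw [h0, zero_smul, zero_add] at hg
    have := h _ _ _ hg
    intro i; fin_cases i <;> simp [this, h0]
  have := finrank_span_eq_card hl
  have e : Set.range ![w, x, y, z] = {w, x, y, z} := by
    ext w; simp [eq_comm]; tauto
  rw [e] at this
  simpa using this

/-- number of cap points in the hyperplane `f = 0` -/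
noncomputable def hh {F : Type*} [Field F] {V : Type*} [AddCommGroup V] [Module F V]
    {ι : Type*} [Fintype ι] (v : ι → V) (f : Module.Dual F V) : ℤ :=
  ∑ l, if f (v l) = 0 then 1 else 0

theorem hh_zero : hh v (0 : Module.Dual F V) = (Fintype.card ι : ℤ) := by
  simp [hh]

theorem hh_pair (f : Module.Dual F V) (φ : ℤ) :
    hh v f * (hh v f - 1) * φ = ∑ i, ∑ j ∈ Finset.univ.erase i,
      (if f (v i) = 0 ∧ f (v j) = 0 then φ else 0) := by
  have : ∀ i, ∑ j ∈ Finset.univ.erase i, (if f (v i) = 0 ∧ f (v j) = 0 then φ else 0) =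
      (if f (v i) = 0 then 1 else 0) * ((hh v f - 1) * φ) := by
    intro i
    unfold hh
    rw [← Finset.add_sum_erase _ _ (Finset.mem_univ i)]
    by_cases h : f (v i) = 0
    · simp only [h, true_and, if_true, one_mul, add_sub_cancel_left, Finset.sum_mul, ite_mul, zero_mul]
    · simp [h]
  simp only [this]
  rw [← Finset.sum_mul]
  unfold hh
  ring

theorem hh_sub_two (f : Module.Dual F V) {i j : ι} (hij : i ≠ j) (hi : f (v i) = 0) (hj : f (v j) = 0) :
    hh v f - 2 = ∑ l ∈ (Finset.univ.erase i).erase j, if f (v l) = 0 then 1 else 0 := by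
  have hj' : j ∈ Finset.univ.erase i := Finset.mem_erase.2 ⟨hij.symm, Finset.mem_univ _⟩
  unfold hh
  rw [← Finset.add_sum_erase _ _ (Finset.mem_univ i), ← Finset.add_sum_erase _ _ hj', if_pos hi, if_pos hj]
  ring

theorem T0 (hV : Module.finrank F V = 5) : ∑ _f : Module.Dual F V, (1 : ℤ) = (Fintype.card F : ℤ) ^ 5 := by
  have := dual_count (F := F) hV ∅ 5 (by simp)
  simpa [Kills] using this

theorem T1 (hV : Module.finrank F V = 5) (hc : CapSys F V ι v) :
    ∑ f : Module.Dual F V, hh v f = (Fintype.card ι : ℤ) * (Fintype.card F : ℤ) ^ 4 := by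
  unfold hh
  rw [Finset.sum_comm, Finset.sum_congr rfl (g := fun _ => (Fintype.card F : ℤ) ^ 4)]
  · rw [Finset.sum_const, Finset.card_univ, nsmul_eq_mul]
  · intro l _
    have := dual_count (F := F) hV {v l} 4 (by rw [fr1 _ (hc.ne l)])
    simpa [Kills] using this

theorem P0 (hV : Module.finrank F V = 5) (hc : CapSys F V ι v) {i j : ι} (hij : i ≠ j) :
    ∑ f : Module.Dual F V, (if f (v i) = 0 ∧ f (v j) = 0 then (1 : ℤ) else 0) = (Fintype.card F : ℤ) ^ 3 := by
  have := dual_count (F := F) hV {v i, v j} 3 (by rw [fr2 _ _ (hc.ind2 i j hij)])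
  simpa [Kills] using this

theorem P1' (hV : Module.finrank F V = 5) (hc : CapSys F V ι v) {i j : ι} (hij : i ≠ j) :
    ∑ f : Module.Dual F V, (if f (v i) = 0 ∧ f (v j) = 0 then hh v f - 2 else 0) = ((Fintype.card ι : ℤ) - 2) * (Fintype.card F : ℤ) ^ 2 := by
  rw [← sum_erase2_const hij, Finset.sum_congr rfl (g := fun f : Module.Dual F V =>
    ∑ l ∈ (Finset.univ.erase i).erase j,
      (if Kills f ({v l, v i, v j} : Set V) then (1 : ℤ) else 0)), Finset.sum_comm]
  · apply Finset.sum_congr rfl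
    intro l hl
    rw [mem_erase2] at hl
    exact dual_count hV _ 2 (by rw [fr3 _ _ _ (hc.ind l i j hl.1.symm hl.2.symm hij)])
  · intro f _
    by_cases h : f (v i) = 0 ∧ f (v j) = 0
    · rw [if_pos h, hh_sub_two f hij h.1 h.2]
      simp [h, Kills]
    · rw [if_neg h]
      symm
      apply Finset.sum_eq_zero
      intro l _
      rw [if_neg]
      intro h'
      exact h ⟨h' _ (by simp), h' _ (by simp)⟩

theorem P2' (hV : Module.finrank F V = 5) (hc : CapSys F V ι v) {i j : ι} (hij : i ≠ j) :
    ∑ f : Module.Dual F V, (if f (v i) = 0 ∧ f (v j) = 0 then (hh v f - 2) ^ 2 else 0)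
      = ((Fintype.card F : ℤ) ^ 2 - (Fintype.card F : ℤ)) * C2 F v i j + ((Fintype.card ι : ℤ) - 2) ^ 2 * (Fintype.card F : ℤ) := by
  have e : ((Fintype.card ι : ℤ) - 2) ^ 2 * (Fintype.card F : ℤ) = ∑ _l ∈ (Finset.univ.erase i).erase j,
      ∑ _l' ∈ (Finset.univ.erase i).erase j, (Fintype.card F : ℤ) := by
    rw [sum_erase2_const hij, sum_erase2_const hij]; ring
  rw [e]
  unfold C2
  rw [Finset.mul_sum, ← Finset.sum_add_distrib, Finset.sum_congr rfl (g := fun f : Module.Dual F V =>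
    ∑ l ∈ (Finset.univ.erase i).erase j, ∑ l' ∈ (Finset.univ.erase i).erase j,
      (if Kills f ({v l', v l, v i, v j} : Set V) then (1 : ℤ) else 0)), Finset.sum_comm]
  · apply Finset.sum_congr rfl
    intro l hl
    rw [mem_erase2] at hl
    rw [Finset.sum_comm, Finset.mul_sum, ← Finset.sum_add_distrib]
    apply Finset.sum_congr rfl
    intro l' _
    have hind := hc.ind l i j hl.1.symm hl.2.symm hij
    by_cases h : v l' ∈ span F {v l, v i, v j}
    · rw [dual_count hV _ 2, if_pos h]
      · ring
      · rw [span_insert_eq_span h, fr3 _ _ _ hind]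
    · rw [dual_count hV _ 1, if_neg h]
      · ring
      · rw [fr4 _ _ _ _ hind h]
  · intro f _
    by_cases h : f (v i) = 0 ∧ f (v j) = 0
    · rw [if_pos h, hh_sub_two f hij h.1 h.2, sq, Finset.sum_mul_sum]
      apply Finset.sum_congr rfl
      intro l _
      apply Finset.sum_congr rfl
      intro l' _
      by_cases h1 : f (v l) = 0 <;> by_cases h2 : f (v l') = 0 <;> simp [h, h1, h2, Kills]
    · rw [if_neg h]
      symm
      apply Finset.sum_eq_zero
      intro l _
      apply Finset.sum_eq_zero
      intro l' _
      rw [if_neg]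
      intro h'
      exact h ⟨h' _ (by simp), h' _ (by simp)⟩

theorem sum_pair_swap (φ : Module.Dual F V → ℤ) :
    ∑ f : Module.Dual F V, hh v f * (hh v f - 1) * φ f = ∑ i, ∑ j ∈ Finset.univ.erase i,
      ∑ f : Module.Dual F V, (if f (v i) = 0 ∧ f (v j) = 0 then φ f else 0) := by
  simp only [hh_pair]
  rw [Finset.sum_comm]
  apply Finset.sum_congr rfl
  intro i _
  rw [Finset.sum_comm]

theorem sum_pairs_const (c : ℤ) : ∑ i : ι, ∑ _j ∈ Finset.univ.erase i, c = (Fintype.card ι : ℤ) * ((Fintype.card ι : ℤ) - 1) * c := by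
  simp only [sum_erase_const]
  rw [Finset.sum_const, Finset.card_univ, nsmul_eq_mul]; ring

theorem T2 (hV : Module.finrank F V = 5) (hc : CapSys F V ι v) :
    ∑ f : Module.Dual F V, hh v f * (hh v f - 1) = (Fintype.card ι : ℤ) * ((Fintype.card ι : ℤ) - 1) * (Fintype.card F : ℤ) ^ 3 := by
  have := sum_pair_swap (v := v) (fun _ : Module.Dual F V => 1)
  simp only [mul_one] at this
  rw [this, ← sum_pairs_const]
  exact Finset.sum_congr rfl fun i _ => Finset.sum_congr rfl fun j hj =>
    P0 hV hc (Finset.ne_of_mem_erase hj).symm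

theorem T3 (hV : Module.finrank F V = 5) (hc : CapSys F V ι v) :
    ∑ f : Module.Dual F V, hh v f * (hh v f - 1) * (hh v f - 2) = (Fintype.card ι : ℤ) * ((Fintype.card ι : ℤ) - 1) * (((Fintype.card ι : ℤ) - 2) * (Fintype.card F : ℤ) ^ 2) := by
  rw [sum_pair_swap, ← sum_pairs_const]
  exact Finset.sum_congr rfl fun i _ => Finset.sum_congr rfl fun j hj =>
    P1' hV hc (Finset.ne_of_mem_erase hj).symm

theorem T4 (hV : Module.finrank F V = 5) [CharP F 2] (hc : CapSys F V ι v) :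
    ∑ f : Module.Dual F V, hh v f * (hh v f - 1) * (hh v f - 2) ^ 2 ≤
      ((Fintype.card F : ℤ) - 1) * ((Fintype.card F : ℤ) ^ 2 * (Fintype.card ι : ℤ) * (((Fintype.card F : ℤ) ^ 3 + (Fintype.card F : ℤ) ^ 2 + (Fintype.card F : ℤ) + 2 - (Fintype.card ι : ℤ)) * ((Fintype.card F : ℤ) ^ 3 + (Fintype.card F : ℤ) ^ 2 + (Fintype.card F : ℤ) + 2 - (Fintype.card ι : ℤ) - 1)))
      + ((Fintype.card F : ℤ) - 1) * ((Fintype.card ι : ℤ) * ((Fintype.card ι : ℤ) - 1) * ((Fintype.card F : ℤ) ^ 3 * ((Fintype.card F : ℤ) ^ 2 + (Fintype.card F : ℤ) + 1) - 2 * (Fintype.card F : ℤ) ^ 2 * ((Fintype.card F : ℤ) ^ 3 + (Fintype.card F : ℤ) ^ 2 + (Fintype.card F : ℤ) + 2 - (Fintype.card ι : ℤ))))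
      + (Fintype.card ι : ℤ) * ((Fintype.card ι : ℤ) - 1) * ((Fintype.card ι : ℤ) - 2) ^ 2 * (Fintype.card F : ℤ) := by
  have hq2 : 2 ≤ (Fintype.card F : ℤ) := by exact_mod_cast (Fintype.one_lt_card : 1 < Fintype.card F)
  rw [sum_pair_swap, Finset.sum_congr rfl fun i _ => Finset.sum_congr rfl fun j hj =>
    P2' hV hc (Finset.ne_of_mem_erase hj).symm]
  have h1 := D2_le hV hc
  rw [Finset.sum_congr rfl fun i _ => Finset.sum_congr rfl fun j hj =>
    D2_eq hV hc (Finset.ne_of_mem_erase hj).symm] at h1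
  simp only [Finset.sum_add_distrib, ← Finset.mul_sum, sum_pairs_const] at h1 ⊢
  generalize ∑ i, ∑ j ∈ Finset.univ.erase i, C2 F v i j = S at h1 ⊢
  refine le_of_mul_le_mul_left ?_ (show 0 < (Fintype.card F : ℤ) by linarith)
  linarith

end cap

section cap
open Submodule
open scoped Classical
variable {F : Type*} [Field F] [Fintype F] {V : Type*} [AddCommGroup V] [Module F V] [Fintype V]
  {ι : Type*} [Fintype ι] {v : ι → V} [Fintype (Module.Dual F V)]

theorem t_nonneg (hV : Module.finrank F V = 5) (hc : CapSys F V ι v) (i₀ : ι) :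
    0 ≤ (Fintype.card F : ℤ) ^ 3 + (Fintype.card F : ℤ) ^ 2 + (Fintype.card F : ℤ) + 2 - (Fintype.card ι : ℤ) := by
  have hq2 : 2 ≤ (Fintype.card F : ℤ) := by exact_mod_cast (Fintype.one_lt_card : 1 < Fintype.card F)
  have h1 := tan_total hV hc i₀
  have h2 : 0 ≤ ∑ y : V, (if Tan F v i₀ y then (1 : ℤ) else 0) :=
    Finset.sum_nonneg fun y _ => by split_ifs <;> norm_num
  rw [h1] at h2
  exact nonneg_of_mul_nonneg_right h2 (by nlinarith)

theorem hh_nonneg (f : Module.Dual F V) : 0 ≤ hh v f :=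
  Finset.sum_nonneg fun y _ => by split_ifs <;> norm_num

theorem hh_le (hV : Module.finrank F V = 5) (hc : CapSys F V ι v) (f : Module.Dual F V) (hf : f ≠ 0) :
    hh v f ≤ (Fintype.card F : ℤ) ^ 2 + (Fintype.card F : ℤ) + 2 := by
  have hq2 : 2 ≤ (Fintype.card F : ℤ) := by exact_mod_cast (Fintype.one_lt_card : 1 < Fintype.card F)
  by_cases h : ∃ i, f (v i) = 0
  · obtain ⟨i, hi⟩ := h
    have h1 := tan_ker_mem hV hc f hf i hi
    have h2 : 0 ≤ ∑ y : V, (if f y = 0 ∧ Tan F v i y then (1 : ℤ) else 0) :=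
      Finset.sum_nonneg fun y _ => by split_ifs <;> norm_num
    rw [h1] at h2
    have := nonneg_of_mul_nonneg_right h2 (by nlinarith)
    unfold hh
    linarith
  · push Not at h
    have : hh v f = 0 := by simp [hh, h]
    rw [this]; positivity

theorem not_tan_of_mem {i : ι} {y : V} (hi : y ∈ span F {v i}) (l : ι) : ¬ Tan F v l y := by
  intro h
  by_cases hl : i = l
  · subst hl; exact h.1 hi
  · exact h.2 i hl (by rw [Set.pair_comm]; exact span1_le2 _ _ hi)

theorem dichotomy (hV : Module.finrank F V = 5) [CharP F 2] (hc : CapSys F V ι v) (i₀ : ι)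
    (f : Module.Dual F V) (hf : f ≠ 0) :
    (Fintype.card F : ℤ) * (hh v f * ((Fintype.card F : ℤ) ^ 2 + (Fintype.card F : ℤ) + 2 - hh v f)) ≤
      ((Fintype.card F : ℤ) ^ 3 + (Fintype.card F : ℤ) ^ 2 + (Fintype.card F : ℤ) + 2 - (Fintype.card ι : ℤ)) * ((Fintype.card F : ℤ) ^ 3 + (Fintype.card F : ℤ) ^ 2 + (Fintype.card F : ℤ) + 2 - (Fintype.card ι : ℤ) - 1) := by
  have hq2 : 2 ≤ (Fintype.card F : ℤ) := by exact_mod_cast (Fintype.one_lt_card : 1 < Fintype.card F)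
  have ht := t_nonneg hV hc i₀
  have e1 : ∑ y : V, (if f y = 0 then ∑ i, (if Tan F v i y then (1 : ℤ) else 0) else 0) =
      hh v f * (((Fintype.card F : ℤ) ^ 2 - (Fintype.card F : ℤ)) * ((Fintype.card F : ℤ) ^ 2 + (Fintype.card F : ℤ) + 2 - hh v f)) +
      ((Fintype.card ι : ℤ) - hh v f) * (((Fintype.card F : ℤ) - 1) * ((Fintype.card F : ℤ) ^ 3 + (Fintype.card F : ℤ) ^ 2 + (Fintype.card F : ℤ) + 2 - (Fintype.card ι : ℤ))) := by
    have : ∀ i, ∑ y : V, (if f y = 0 ∧ Tan F v i y then (1 : ℤ) else 0) =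
        (if f (v i) = 0 then 1 else 0) * (((Fintype.card F : ℤ) ^ 2 - (Fintype.card F : ℤ)) * ((Fintype.card F : ℤ) ^ 2 + (Fintype.card F : ℤ) + 2 - hh v f)) +
        (1 - (if f (v i) = 0 then 1 else 0)) * (((Fintype.card F : ℤ) - 1) * ((Fintype.card F : ℤ) ^ 3 + (Fintype.card F : ℤ) ^ 2 + (Fintype.card F : ℤ) + 2 - (Fintype.card ι : ℤ))) := by
      intro i
      split_ifs with h
      · rw [tan_ker_mem hV hc f hf i h]; unfold hh; ring
      · rw [tan_ker_notMem hV hc f hf i h]; ring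
    rw [Finset.sum_congr rfl (g := fun y : V => ∑ i, (if f y = 0 ∧ Tan F v i y then (1 : ℤ) else 0)),
      Finset.sum_comm]
    · simp only [this]
      rw [Finset.sum_add_distrib, ← Finset.sum_mul, ← Finset.sum_mul, Finset.sum_sub_distrib,
        Finset.sum_const, Finset.card_univ, nsmul_eq_mul, mul_one]
      rfl
    · intro y _
      by_cases h : f y = 0 <;> simp [h]
  have e2 : ∑ y : V, (if f y = 0 then ∑ i, (if Tan F v i y then (1 : ℤ) else 0) else 0) ≤
      ∑ y : V, ((Fintype.card F : ℤ) ^ 3 + (Fintype.card F : ℤ) ^ 2 + (Fintype.card F : ℤ) + 2 - (Fintype.card ι : ℤ)) * ((if y ∈ LinearMap.ker f then (1 : ℤ) else 0)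
        - (if y ∈ (⊥ : Submodule F V) then 1 else 0)
        - ∑ l, (if f (v l) = 0 then 1 else 0) *
          ((if y ∈ span F {v l} then (1 : ℤ) else 0) - (if y ∈ (⊥ : Submodule F V) then 1 else 0))) := by
    apply Finset.sum_le_sum
    intro y _
    by_cases hy : y = 0
    · subst hy
      have : ∀ l, ¬ Tan F v l 0 := fun l => not_tan_of_mem (i := i₀) (zero_mem _) l
      simp [this]
    by_cases hfy : f y = 0
    · simp only [hfy, if_true, LinearMap.mem_ker, mem_bot, hy, if_false, sub_zero]
      by_cases hl : ∃ l, y ∈ span F {v l}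
      · obtain ⟨l, hl⟩ := hl
        have : ∀ l, ¬ Tan F v l y := fun l' => not_tan_of_mem hl l'
        simp only [this, if_false, Finset.sum_const_zero]
        apply mul_nonneg ht
        rw [Finset.sum_eq_single l]
        · split_ifs <;> norm_num
        · intro l' _ hne
          have : y ∉ span F {v l'} := by
            intro h'
            obtain ⟨a, ha⟩ := mem_span_singleton.1 hl
            obtain ⟨b, hb⟩ := mem_span_singleton.1 h'
            have := hc.ind2 l l' hne.symm a (-b) (by rw [neg_smul, ha, hb, add_neg_cancel])
            apply hy
            rw [← ha, this.1, zero_smul]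
          simp [this]
        · simp
      · push Not at hl
        simp only [hl, if_false, mul_zero, Finset.sum_const_zero, sub_zero, mul_one]
        exact n_le hV hc y i₀
    · rw [if_neg hfy]
      apply mul_nonneg ht
      rw [Finset.sum_eq_zero]
      · simp [hfy, hy]
      · intro l _
        by_cases h : f (v l) = 0
        · have : y ∉ span F {v l} := by
            intro h'
            obtain ⟨a, ha⟩ := mem_span_singleton.1 h'
            exact hfy (by rw [← ha, map_smul, h, smul_zero])
          simp [this, hy]
        · simp [h]
  have e3 : ∑ y : V, ((Fintype.card F : ℤ) ^ 3 + (Fintype.card F : ℤ) ^ 2 + (Fintype.card F : ℤ) + 2 - (Fintype.card ι : ℤ)) * ((if y ∈ LinearMap.ker f then (1 : ℤ) else 0)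
        - (if y ∈ (⊥ : Submodule F V) then 1 else 0)
        - ∑ l, (if f (v l) = 0 then 1 else 0) *
          ((if y ∈ span F {v l} then (1 : ℤ) else 0) - (if y ∈ (⊥ : Submodule F V) then 1 else 0))) =
      ((Fintype.card F : ℤ) ^ 3 + (Fintype.card F : ℤ) ^ 2 + (Fintype.card F : ℤ) + 2 - (Fintype.card ι : ℤ)) * ((Fintype.card F : ℤ) ^ 4 - 1 - hh v f * ((Fintype.card F : ℤ) - 1)) := by
    rw [← Finset.mul_sum, Finset.sum_sub_distrib, Finset.sum_sub_distrib, card_sub, card_sub,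
      fr_ker hV f hf, finrank_bot, pow_zero, Finset.sum_comm]
    simp only [← Finset.mul_sum, Finset.sum_sub_distrib, card_span1 hc]
    rw [card_sub, finrank_bot, pow_zero, ← Finset.sum_mul]
    rfl
  rw [e1, e3] at e2
  refine le_of_mul_le_mul_left ?_ (show 0 < (Fintype.card F : ℤ) - 1 by linarith)
  linarith

theorem t_ne_zero (hV : Module.finrank F V = 5) [CharP F 2] (hc : CapSys F V ι v) (i₀ : ι)
    (hq : 2048 ≤ (Fintype.card F : ℤ)) : (Fintype.card F : ℤ) ^ 3 + (Fintype.card F : ℤ) ^ 2 + (Fintype.card F : ℤ) + 2 - (Fintype.card ι : ℤ) ≠ 0 := by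
  intro h0
  have hD : ∀ f : Module.Dual F V, f ≠ 0 → ((Fintype.card F : ℤ) ^ 2 + (Fintype.card F : ℤ) + 2) ∣ hh v f := by
    intro f hf
    have h1 := dichotomy hV hc i₀ f hf
    have h2 := hh_nonneg (v := v) f
    have h3 := hh_le hV hc f hf
    rw [h0, zero_mul] at h1
    have h4 : hh v f * ((Fintype.card F : ℤ) ^ 2 + (Fintype.card F : ℤ) + 2 - hh v f) = 0 := by
      apply le_antisymm
      · by_contra h; push Not at h; nlinarith
      · exact mul_nonneg h2 (by linarith)
    rcases mul_eq_zero.1 h4 with h | h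
    · rw [h]; exact dvd_zero _
    · rw [sub_eq_zero.1 h]
  have h1 := T1 (v := v) hV hc
  rw [← Finset.add_sum_erase _ _ (Finset.mem_univ (0 : Module.Dual F V)), hh_zero] at h1
  have h2 : ((Fintype.card F : ℤ) ^ 2 + (Fintype.card F : ℤ) + 2) ∣ ∑ f ∈ Finset.univ.erase (0 : Module.Dual F V), hh v f :=
    Finset.dvd_sum fun f hf => hD f (Finset.ne_of_mem_erase hf)
  have h3 : ∑ f ∈ Finset.univ.erase (0 : Module.Dual F V), hh v f = (Fintype.card ι : ℤ) * (Fintype.card F : ℤ) ^ 4 - (Fintype.card ι : ℤ) := by linarith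
  have hk : (Fintype.card ι : ℤ) = (Fintype.card F : ℤ) ^ 3 + (Fintype.card F : ℤ) ^ 2 + (Fintype.card F : ℤ) + 2 := by linarith
  rw [h3, hk] at h2
  have h4 : ((Fintype.card F : ℤ) ^ 2 + (Fintype.card F : ℤ) + 2) ∣ 8 * (Fintype.card F : ℤ) + 8 := by
    have e : 8 * (Fintype.card F : ℤ) + 8 = (((Fintype.card F : ℤ) ^ 3 + (Fintype.card F : ℤ) ^ 2 + (Fintype.card F : ℤ) + 2) * (Fintype.card F : ℤ) ^ 4 - ((Fintype.card F : ℤ) ^ 3 + (Fintype.card F : ℤ) ^ 2 + (Fintype.card F : ℤ) + 2)) -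
      ((Fintype.card F : ℤ) ^ 2 + (Fintype.card F : ℤ) + 2) * ((Fintype.card F : ℤ) ^ 5 - (Fintype.card F : ℤ) ^ 3 + 3 * (Fintype.card F : ℤ) ^ 2 - 2 * (Fintype.card F : ℤ) - 5) := by ring
    rw [e]
    exact dvd_sub h2 (dvd_mul_right _ _)
  have h5 := Int.le_of_dvd (by linarith) h4
  nlinarith

theorem inter_count (hV : Module.finrank F V = 5) (hc : CapSys F V ι v) {f g : Module.Dual F V}
    (hf : f ≠ 0) (hfg : g ∉ span F {f}) {i : ι} (hi : f (v i) = 0) (hi' : g (v i) = 0) :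
    ∑ y : V, (if f y = 0 ∧ g y = 0 ∧ Tan F v i y then (1 : ℤ) else 0) ≤ (Fintype.card F : ℤ) ^ 3 - (Fintype.card F : ℤ) := by
  have hq2 : 2 ≤ (Fintype.card F : ℤ) := by exact_mod_cast (Fintype.one_lt_card : 1 < Fintype.card F)
  have hlt : LinearMap.ker f ⊓ LinearMap.ker g < LinearMap.ker f := by
    refine lt_of_le_of_ne inf_le_left fun h => hfg ?_
    have h1 : LinearMap.ker f ≤ LinearMap.ker g := inf_eq_left.1 h
    have := mem_span_of_iInf_ker_le_ker (L := fun _ : Unit => f) (K := g) (by simpa using h1)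
    simpa using this
  have h3 := finrank_lt_finrank_of_lt hlt
  rw [fr_ker hV f hf] at h3
  calc _ ≤ ∑ y : V, ((if y ∈ LinearMap.ker f ⊓ LinearMap.ker g then (1 : ℤ) else 0)
        - (if y ∈ span F {v i} then 1 else 0)) := by
        apply Finset.sum_le_sum
        intro y _
        by_cases hy : y ∈ span F {v i}
        · have : ¬ Tan F v i y := fun h => h.1 hy
          obtain ⟨a, rfl⟩ := mem_span_singleton.1 hy
          simp [hi, hi', this, hy]
        · by_cases h1 : f y = 0 <;> by_cases h2 : g y = 0 <;> simp [h1, h2, hy]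
          split_ifs <;> norm_num
    _ = (Fintype.card F : ℤ) ^ (Module.finrank F ↥(LinearMap.ker f ⊓ LinearMap.ker g)) - (Fintype.card F : ℤ) := by
        rw [Finset.sum_sub_distrib, card_sub, card_span1 hc]
    _ ≤ _ := by
        have := pow_le_pow_right₀ (show 1 ≤ (Fintype.card F : ℤ) by linarith) (show Module.finrank F ↥(LinearMap.ker f ⊓ LinearMap.ker g) ≤ 3 by omega)
        linarith

theorem bonf2 (hV : Module.finrank F V = 5) (hc : CapSys F V ι v) {f g : Module.Dual F V}
    (hf : f ≠ 0) (hg : g ≠ 0) (hfg : g ∉ span F {f}) {i : ι} (hi : f (v i) = 0) (hi' : g (v i) = 0) :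
    2 * (Fintype.card F : ℤ) ^ 2 + (Fintype.card F : ℤ) + 3 - ((Fintype.card F : ℤ) ^ 3 + (Fintype.card F : ℤ) ^ 2 + (Fintype.card F : ℤ) + 2 - (Fintype.card ι : ℤ)) ≤ hh v f + hh v g := by
  have hq2 : 2 ≤ (Fintype.card F : ℤ) := by exact_mod_cast (Fintype.one_lt_card : 1 < Fintype.card F)
  have h1 := inter_count hV hc hf hfg hi hi'
  have h2 := tan_ker_mem hV hc f hf i hi
  have h3 := tan_ker_mem hV hc g hg i hi'
  have h4 : ∑ y : V, (if f y = 0 ∧ Tan F v i y then (1 : ℤ) else 0) +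
      ∑ y : V, (if g y = 0 ∧ Tan F v i y then (1 : ℤ) else 0) ≤
      ∑ y : V, (if Tan F v i y then (1 : ℤ) else 0) +
      ∑ y : V, (if f y = 0 ∧ g y = 0 ∧ Tan F v i y then (1 : ℤ) else 0) := by
    rw [← Finset.sum_add_distrib, ← Finset.sum_add_distrib]
    apply Finset.sum_le_sum
    intro y _
    by_cases a : f y = 0 <;> by_cases b : g y = 0 <;> by_cases c : Tan F v i y <;> simp [a, b, c]
  rw [h2, h3, tan_total hV hc i] at h4
  change ((Fintype.card F : ℤ) ^ 2 - (Fintype.card F : ℤ)) * ((Fintype.card F : ℤ) ^ 2 + (Fintype.card F : ℤ) + 2 - hh v f) + ((Fintype.card F : ℤ) ^ 2 - (Fintype.card F : ℤ)) * ((Fintype.card F : ℤ) ^ 2 + (Fintype.card F : ℤ) + 2 - hh v g) ≤ _ at h4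
  refine le_of_mul_le_mul_left ?_ (show 0 < (Fintype.card F : ℤ) ^ 2 - (Fintype.card F : ℤ) by nlinarith)
  linarith

theorem bonf3 (hV : Module.finrank F V = 5) (hc : CapSys F V ι v) {f g e : Module.Dual F V}
    (hf : f ≠ 0) (hg : g ≠ 0) (he : e ≠ 0) (hfg : g ∉ span F {f}) (hfe : e ∉ span F {f})
    (hge : e ∉ span F {g}) {i : ι} (hi : f (v i) = 0) (hi' : g (v i) = 0) (hi'' : e (v i) = 0) :
    3 * (Fintype.card F : ℤ) ^ 2 + 3 - ((Fintype.card F : ℤ) ^ 3 + (Fintype.card F : ℤ) ^ 2 + (Fintype.card F : ℤ) + 2 - (Fintype.card ι : ℤ)) ≤ hh v f + hh v g + hh v e := by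
  have hq2 : 2 ≤ (Fintype.card F : ℤ) := by exact_mod_cast (Fintype.one_lt_card : 1 < Fintype.card F)
  have h1 := inter_count hV hc hf hfg hi hi'
  have h1' := inter_count hV hc hf hfe hi hi''
  have h1'' := inter_count hV hc hg hge hi' hi''
  have h2 := tan_ker_mem hV hc f hf i hi
  have h3 := tan_ker_mem hV hc g hg i hi'
  have h3' := tan_ker_mem hV hc e he i hi''
  have h4 : ∑ y : V, (if f y = 0 ∧ Tan F v i y then (1 : ℤ) else 0) +
      ∑ y : V, (if g y = 0 ∧ Tan F v i y then (1 : ℤ) else 0) +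
      ∑ y : V, (if e y = 0 ∧ Tan F v i y then (1 : ℤ) else 0) ≤
      ∑ y : V, (if Tan F v i y then (1 : ℤ) else 0) +
      ∑ y : V, (if f y = 0 ∧ g y = 0 ∧ Tan F v i y then (1 : ℤ) else 0) +
      ∑ y : V, (if f y = 0 ∧ e y = 0 ∧ Tan F v i y then (1 : ℤ) else 0) +
      ∑ y : V, (if g y = 0 ∧ e y = 0 ∧ Tan F v i y then (1 : ℤ) else 0) := by
    simp only [← Finset.sum_add_distrib]
    apply Finset.sum_le_sum
    intro y _
    by_cases a : f y = 0 <;> by_cases b : g y = 0 <;> by_cases d : e y = 0 <;>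
      by_cases c : Tan F v i y <;> simp [a, b, c, d]
  rw [h2, h3, h3', tan_total hV hc i] at h4
  change ((Fintype.card F : ℤ) ^ 2 - (Fintype.card F : ℤ)) * ((Fintype.card F : ℤ) ^ 2 + (Fintype.card F : ℤ) + 2 - hh v f) + ((Fintype.card F : ℤ) ^ 2 - (Fintype.card F : ℤ)) * ((Fintype.card F : ℤ) ^ 2 + (Fintype.card F : ℤ) + 2 - hh v g)
    + ((Fintype.card F : ℤ) ^ 2 - (Fintype.card F : ℤ)) * ((Fintype.card F : ℤ) ^ 2 + (Fintype.card F : ℤ) + 2 - hh v e) ≤ _ at h4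
  refine le_of_mul_le_mul_left ?_ (show 0 < (Fintype.card F : ℤ) ^ 2 - (Fintype.card F : ℤ) by nlinarith)
  linarith

theorem hh_smul (f : Module.Dual F V) (c : F) (hc : c ≠ 0) : hh v (c • f) = hh v f := by
  unfold hh
  simp [hc]

theorem class_sum (S : Finset (Module.Dual F V)) (w : Module.Dual F V → ℝ) (hw : ∀ f, 0 ≤ w f)
    (hS : ∀ f ∈ S, f ≠ 0) (hinv : ∀ (c : F) f, c ≠ 0 → w (c • f) = w f) (f₁ : Module.Dual F V) :
    ∑ f ∈ S.filter (fun f => f ∈ span F {f₁}), w f ≤ ((Fintype.card F : ℝ) - 1) * w f₁ := by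
  have hsub : S.filter (fun f => f ∈ span F {f₁}) ⊆ ((Finset.univ : Finset F).erase 0).image (fun c => c • f₁) := by
    intro f hf
    obtain ⟨h1, h2⟩ := Finset.mem_filter.1 hf
    obtain ⟨c, rfl⟩ := mem_span_singleton.1 h2
    refine Finset.mem_image.2 ⟨c, Finset.mem_erase.2 ⟨?_, Finset.mem_univ _⟩, rfl⟩
    rintro rfl
    exact hS _ h1 (zero_smul _ _)
  refine (Finset.sum_le_sum_of_subset_of_nonneg hsub fun f _ _ => hw f).trans ?_
  have : ∀ f ∈ ((Finset.univ : Finset F).erase 0).image (fun c => c • f₁), w f = w f₁ := by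
    intro f hf
    obtain ⟨c, hc, rfl⟩ := Finset.mem_image.1 hf
    exact hinv c f₁ (Finset.ne_of_mem_erase hc)
  rw [Finset.sum_congr rfl this, Finset.sum_const, nsmul_eq_mul]
  apply mul_le_mul_of_nonneg_right _ (hw _)
  have h1 : (((Finset.univ : Finset F).erase 0).image (fun c => c • f₁)).card + 1 ≤ Fintype.card F := by
    have := Finset.card_image_le (s := (Finset.univ : Finset F).erase 0) (f := fun c => c • f₁)
    have h2 := Finset.card_erase_add_one (Finset.mem_univ (0 : F))
    rw [Finset.card_univ] at h2
    omega
  have : ((((Finset.univ : Finset F).erase 0).image (fun c => c • f₁)).card : ℝ) + 1 ≤ Fintype.card F := by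
    exact_mod_cast h1
  linarith

theorem two_class_sum (S : Finset (Module.Dual F V)) (w : Module.Dual F V → ℝ) (hw : ∀ f, 0 ≤ w f)
    (hS : ∀ f ∈ S, f ≠ 0) (hinv : ∀ (c : F) f, c ≠ 0 → w (c • f) = w f) (W : ℝ) (hW : 0 ≤ W)
    (h1 : ∀ f ∈ S, w f ≤ W) (h2 : ∀ f ∈ S, ∀ g ∈ S, g ∉ span F {f} → w f + w g ≤ W)
    (h3 : ∀ f ∈ S, ∀ g ∈ S, ∀ e ∈ S, g ∉ span F {f} → e ∉ span F {f} → e ∉ span F {g} → False) :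
    ∑ f ∈ S, w f ≤ ((Fintype.card F : ℝ) - 1) * W := by
  have hq1 : (0 : ℝ) ≤ (Fintype.card F : ℝ) - 1 := by
    have : 1 < Fintype.card F := Fintype.one_lt_card
    have : (1 : ℝ) < Fintype.card F := by exact_mod_cast this
    linarith
  rcases S.eq_empty_or_nonempty with rfl | ⟨f, hf⟩
  · simpa using mul_nonneg hq1 hW
  rw [← Finset.sum_filter_add_sum_filter_not S (fun g => g ∈ span F {f})]
  have c1 := class_sum S w hw hS hinv f
  rcases (S.filter (fun g => ¬ g ∈ span F {f})).eq_empty_or_nonempty with h | ⟨g, hg⟩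
  · rw [h, Finset.sum_empty, add_zero]
    exact c1.trans (mul_le_mul_of_nonneg_left (h1 f hf) hq1)
  · obtain ⟨hg1, hg2⟩ := Finset.mem_filter.1 hg
    have c2 := class_sum S w hw hS hinv g
    have hsub : S.filter (fun g => ¬ g ∈ span F {f}) ⊆ S.filter (fun e => e ∈ span F {g}) := by
      intro e he
      obtain ⟨he1, he2⟩ := Finset.mem_filter.1 he
      refine Finset.mem_filter.2 ⟨he1, ?_⟩
      by_contra h
      exact h3 f hf g hg1 e he1 hg2 he2 h
    have c3 := Finset.sum_le_sum_of_subset_of_nonneg hsub fun f _ _ => hw f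
    calc _ ≤ ((Fintype.card F : ℝ) - 1) * w f + ((Fintype.card F : ℝ) - 1) * w g := by linarith
      _ = ((Fintype.card F : ℝ) - 1) * (w f + w g) := by ring
      _ ≤ _ := mul_le_mul_of_nonneg_left (h2 f hf g hg1 hg2) hq1

theorem certificate (hV : Module.finrank F V = 5) [CharP F 2] (hc : CapSys F V ι v)
    (q k t : ℝ) (hq : q = Fintype.card F) (hk : k = Fintype.card ι) (ht : t = q ^ 3 + q ^ 2 + q + 2 - k)
    (a0 a1 a2 a3 W : ℝ) (w : Module.Dual F V → ℝ)
    (H1 : ∀ f, f ≠ 0 → 0 ≤ a0 + a1 * hh v f + a2 * (hh v f * (hh v f - 1))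
      + a3 * (hh v f * (hh v f - 1) * (hh v f - 2)) + hh v f * (hh v f - 1) * (hh v f - 2) ^ 2
      + hh v f * w f)
    (H2 : ∀ i, ∑ f ∈ Finset.univ.filter (fun f : Module.Dual F V => f ≠ 0 ∧ f (v i) = 0), w f ≤ (q - 1) * W) :
    0 ≤ a0 * (q ^ 4 + q ^ 3 + q ^ 2 + q + 1) + a1 * (k * (q ^ 3 + q ^ 2 + q + 1))
      + a2 * (k * (k - 1) * (q ^ 2 + q + 1)) + a3 * (k * (k - 1) * (k - 2) * (q + 1))
      + (k * (k - 1) * (k - 2) ^ 2 + k * (k - 1) * (q ^ 3 * (q ^ 2 + q + 1) - 2 * q ^ 2 * t)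
        + q ^ 2 * k * (t * (t - 1))) + k * W := by
  have hq1 : (0 : ℝ) < q - 1 := by
    have : 1 < Fintype.card F := Fintype.one_lt_card
    have : (1 : ℝ) < Fintype.card F := by exact_mod_cast this
    rw [hq]; linarith
  have m0 := T0 (F := F) (V := V) hV
  have m1 := T1 hV hc
  have m2 := T2 hV hc
  have m3 := T3 hV hc
  have m4 := T4 hV hc
  rw [← Finset.add_sum_erase _ _ (Finset.mem_univ (0 : Module.Dual F V))] at m0 m1 m2 m3 m4
  rw [hh_zero] at m1 m2 m3 m4
  have s := Finset.sum_nonneg (s := Finset.univ.erase (0 : Module.Dual F V))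
    fun f hf => H1 f (Finset.ne_of_mem_erase hf)
  simp only [Finset.sum_add_distrib, ← Finset.mul_sum] at s
  have hw : ∑ f ∈ Finset.univ.erase (0 : Module.Dual F V), (hh v f : ℝ) * w f ≤ k * ((q - 1) * W) := by
    have e : ∀ f : Module.Dual F V, (hh v f : ℝ) * w f = ∑ i, if f (v i) = 0 then w f else 0 := by
      intro f
      unfold hh
      push_cast
      rw [Finset.sum_mul]
      apply Finset.sum_congr rfl
      intro i _
      split_ifs <;> simp
    simp only [e]
    rw [Finset.sum_comm]
    calc _ ≤ ∑ _i : ι, (q - 1) * W := by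
          apply Finset.sum_le_sum
          intro i _
          refine le_trans (le_of_eq ?_) (H2 i)
          rw [← Finset.sum_filter]
          apply Finset.sum_congr _ fun _ _ => rfl
          ext f; simp
      _ = _ := by rw [Finset.sum_const, Finset.card_univ, nsmul_eq_mul, hk]
  have m0' : ∑ f ∈ Finset.univ.erase (0 : Module.Dual F V), a0 = a0 * (q ^ 5 - 1) := by
    have h : (∑ f ∈ Finset.univ.erase (0 : Module.Dual F V), (1 : ℝ)) = q ^ 5 - 1 := by
      rw [hq]; have : ((1 + ∑ x ∈ Finset.univ.erase (0 : Module.Dual F V), 1 : ℤ) : ℝ) = (((Fintype.card F : ℤ) ^ 5 : ℤ) : ℝ) := by rw [m0]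
      push_cast at this ⊢; linarith
    rw [← h, Finset.mul_sum]; simp
  rw [m0'] at s
  have m1' := congrArg (Int.cast : ℤ → ℝ) m1
  have m2' := congrArg (Int.cast : ℤ → ℝ) m2
  have m3' := congrArg (Int.cast : ℤ → ℝ) m3
  have m4' := (Int.cast_le (R := ℝ)).2 m4
  push_cast at m1' m2' m3' m4'
  rw [← hq, ← hk] at m1' m2' m3' m4'
  rw [← ht] at m4'
  generalize ∑ f ∈ Finset.univ.erase (0 : Module.Dual F V), (hh v f : ℝ) = s1 at s m1'
  generalize ∑ f ∈ Finset.univ.erase (0 : Module.Dual F V), ((hh v f : ℝ) * (hh v f - 1)) = s2 at s m2'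
  generalize ∑ f ∈ Finset.univ.erase (0 : Module.Dual F V), ((hh v f : ℝ) * (hh v f - 1) * (hh v f - 2)) = s3 at s m3'
  generalize ∑ f ∈ Finset.univ.erase (0 : Module.Dual F V), ((hh v f : ℝ) * (hh v f - 1) * (hh v f - 2) ^ 2) = s4 at s m4'
  have r1 : s1 = k * (q ^ 4 - 1) := by linarith
  have r2 : s2 = k * (k - 1) * (q ^ 3 - 1) := by linarith
  have r3 : s3 = k * (k - 1) * (k - 2) * (q ^ 2 - 1) := by linarith
  rw [r1, r2, r3] at s
  refine nonneg_of_mul_nonneg_right (a := q - 1) ?_ hq1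
  linarith

end cap

theorem pow_bounds (c : ℝ) (h : |c| ≤ 12) :
    0 ≤ c ^ 2 ∧ c ^ 2 ≤ 144 ∧ -1728 ≤ c ^ 3 ∧ c ^ 3 ≤ 1728 ∧ 0 ≤ c ^ 4 ∧ c ^ 4 ≤ 20736 := by
  obtain ⟨h1, h2⟩ := abs_le.1 h
  have e2 : c ^ 2 ≤ 144 := by nlinarith
  have e3 : |c ^ 3| ≤ 1728 := by
    rw [abs_pow]
    calc |c| ^ 3 ≤ 12 ^ 3 := pow_le_pow_left₀ (abs_nonneg _) h 3
      _ = 1728 := by norm_num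
  obtain ⟨h3, h4⟩ := abs_le.1 e3
  refine ⟨by positivity, e2, h3, h4, by positivity, ?_⟩
  have : c ^ 4 = c ^ 2 * c ^ 2 := by ring
  rw [this]
  nlinarith [sq_nonneg c]

theorem poly_neg (q : ℝ) (hq : 2048 ≤ q) (p8 p7 p6 p5 p4 p3 p2 p1 p0 : ℝ) (h8 : p8 ≤ -1) (h7 : p7 ≤ 1200)
    (h6 : p6 ≤ 1000000) (h5 : p5 ≤ 1000000) (h4 : p4 ≤ 1000000) (h3 : p3 ≤ 1000000) (h2 : p2 ≤ 1000000)
    (h1 : p1 ≤ 1000000) (h0 : p0 ≤ 1000000) :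
    p8 * q ^ 8 + p7 * q ^ 7 + p6 * q ^ 6 + p5 * q ^ 5 + p4 * q ^ 4 + p3 * q ^ 3 + p2 * q ^ 2 + p1 * q + p0 < 0 := by
  have hp : ∀ n : ℕ, 0 < q ^ n := fun n => pow_pos (by linarith) n
  have s : ∀ n : ℕ, 2048 * q ^ n ≤ q ^ (n + 1) := fun n => by
    rw [pow_succ, mul_comm]; exact mul_le_mul_of_nonneg_left hq (hp n).le
  have m8 := mul_le_mul_of_nonneg_right h8 (hp 8).le
  have m7 := mul_le_mul_of_nonneg_right h7 (hp 7).le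
  have m6 := mul_le_mul_of_nonneg_right h6 (hp 6).le
  have m5 := mul_le_mul_of_nonneg_right h5 (hp 5).le
  have m4 := mul_le_mul_of_nonneg_right h4 (hp 4).le
  have m3 := mul_le_mul_of_nonneg_right h3 (hp 3).le
  have m2 := mul_le_mul_of_nonneg_right h2 (hp 2).le
  have m1 := mul_le_mul_of_nonneg_right h1 (show 0 ≤ q by linarith)
  have s7 := s 7
  have s6 := s 6
  have s5 := s 5
  have s4 := s 4
  have s3 := s 3
  have s2 := s 2
  have s1 := s 1
  norm_num at s7 s6 s5 s4 s3 s2 s1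
  have := hp 6
  linarith

theorem final_II2 (q c t k A B r W a0 a1 a2 a3 : ℝ) (hq : 2048 ≤ q) (hc1 : (-3) ≤ c) (hc2 : c ≤ 12)
    (ht : t = 2 * q ^ 2 + c * q) (hk : k = q ^ 3 + q ^ 2 + q + 2 - t) (hA : A = q ^ 2 - q + 2 - c) (hB : B = q ^ 2 - 4 * q)
    (hr : r = 12 * q ^ 2 + 1000 * q) (hW : W = 2 * (A ^ 2 * B - 12 * q ^ 5))
    (h0 : a0 = A ^ 2 * r) (h3 : a3 = -2 * A - B + 5) (h2 : a2 = A ^ 2 + 2 * A * B + r - 8 + 3 * a3)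
    (h1 : a1 = -(A ^ 2 * B) - 2 * A * r + 4 - 2 * a3 + a2) :
    a0 * (q ^ 4 + q ^ 3 + q ^ 2 + q + 1) + a1 * (k * (q ^ 3 + q ^ 2 + q + 1))
      + a2 * (k * (k - 1) * (q ^ 2 + q + 1)) + a3 * (k * (k - 1) * (k - 2) * (q + 1))
      + (k * (k - 1) * (k - 2) ^ 2 + k * (k - 1) * (q ^ 3 * (q ^ 2 + q + 1) - 2 * q ^ 2 * t)
        + q ^ 2 * k * (t * (t - 1))) + k * W < 0 := by
  have b1 : |c| ≤ 12 := abs_le.2 ⟨by linarith, by linarith⟩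
  obtain ⟨c1, c2, c3, c4, c5, c6⟩ := pow_bounds c b1
  have key := poly_neg q hq ((-4) + (-1) * c ^ 1) ((990) + (17) * c ^ 1)
    ((-1990) + (-25) * c ^ 1 + (8) * c ^ 2) ((4978) + (-960) * c ^ 1 + (-32) * c ^ 2 + (1) * c ^ 3)
    ((-6072) + (2060) * c ^ 1 + (23) * c ^ 2 + (-9) * c ^ 3) ((4008) + (-4076) * c ^ 1 + (12) * c ^ 2 + (11) * c ^ 3 + (-1) * c ^ 4)
    ((64) + (4048) * c ^ 1 + (-1053) * c ^ 2 + (6) * c ^ 3 + (1) * c ^ 4) ((-64) + (80) * c ^ 1 + (992) * c ^ 2 + (-4) * c ^ 3) ((4) * c ^ 2)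
    (by linarith) (by linarith) (by linarith) (by linarith) (by linarith) (by linarith) (by linarith)
    (by linarith) (by linarith)
  refine lt_of_eq_of_lt ?_ key
  rw [h1, h2, h3, h0, hW, hr, hB, hA, hk, ht]
  ring

theorem final_I2 (q c t k A B r W a0 a1 a2 a3 : ℝ) (hq : 2048 ≤ q) (hc1 : (-7) ≤ c) (hc2 : c ≤ -3)
    (ht : t = 2 * q ^ 2 + c * q) (hk : k = q ^ 3 + q ^ 2 + q + 2 - t) (hA : A = q ^ 2 - q + 2 - c) (hB : B = q ^ 2 - 4 * q)
    (hr : r = 0) (hW : W = 2 * (A ^ 2 * B) - (A ^ 2 + 2 * A * B) * (q * (1 - c) + 3) + 150 * q ^ 4)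
    (h0 : a0 = A ^ 2 * r) (h3 : a3 = -2 * A - B + 5) (h2 : a2 = A ^ 2 + 2 * A * B + r - 8 + 3 * a3)
    (h1 : a1 = -(A ^ 2 * B) - 2 * A * r + 4 - 2 * a3 + a2) :
    a0 * (q ^ 4 + q ^ 3 + q ^ 2 + q + 1) + a1 * (k * (q ^ 3 + q ^ 2 + q + 1))
      + a2 * (k * (k - 1) * (q ^ 2 + q + 1)) + a3 * (k * (k - 1) * (k - 2) * (q + 1))
      + (k * (k - 1) * (k - 2) ^ 2 + k * (k - 1) * (q ^ 3 * (q ^ 2 + q + 1) - 2 * q ^ 2 * t)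
        + q ^ 2 * k * (t * (t - 1))) + k * W < 0 := by
  have b1 : |c| ≤ 12 := abs_le.2 ⟨by linarith, by linarith⟩
  obtain ⟨c1, c2, c3, c4, c5, c6⟩ := pow_bounds c b1
  have key := poly_neg q hq ((5) + (2) * c ^ 1) ((146) + (2) * c ^ 1)
    ((-163) + (2) * c ^ 1 + (1) * c ^ 2) ((195) + (-182) * c ^ 1 + (-6) * c ^ 2 + (1) * c ^ 3)
    ((292) + (82) * c ^ 1 + (-17) * c ^ 2 + (-4) * c ^ 3) ((-53) + (-35) * c ^ 1 + (46) * c ^ 2 + (-1) * c ^ 4)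
    ((70) + (-78) * c ^ 1 + (-25) * c ^ 2 + (12) * c ^ 3) ((36) + (60) * c ^ 1 + (-33) * c ^ 2 + (1) * c ^ 3) ((-24) + (24) * c ^ 1 + (-2) * c ^ 2)
    (by linarith) (by linarith) (by linarith) (by linarith) (by linarith) (by linarith) (by linarith)
    (by linarith) (by linarith)
  refine lt_of_eq_of_lt ?_ key
  rw [h1, h2, h3, h0, hW, hr, hB, hA, hk, ht]
  ring

theorem final_II1 (q c t k A B r W a0 a1 a2 a3 : ℝ) (hq : 2048 ≤ q) (hc1 : (0) ≤ c) (hc2 : c ≤ 3)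
    (ht : t = q ^ 2 + c * q) (hk : k = q ^ 3 + q ^ 2 + q + 2 - t) (hA : A = q ^ 2 + 2 - c) (hB : B = q ^ 2 - 4 * q)
    (hr : r = 3 * q ^ 2 + 800 * q) (hW : W = A ^ 2 * B - 6 * q ^ 5)
    (h0 : a0 = A ^ 2 * r) (h3 : a3 = -2 * A - B + 5) (h2 : a2 = A ^ 2 + 2 * A * B + r - 8 + 3 * a3)
    (h1 : a1 = -(A ^ 2 * B) - 2 * A * r + 4 - 2 * a3 + a2) :
    a0 * (q ^ 4 + q ^ 3 + q ^ 2 + q + 1) + a1 * (k * (q ^ 3 + q ^ 2 + q + 1))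
      + a2 * (k * (k - 1) * (q ^ 2 + q + 1)) + a3 * (k * (k - 1) * (k - 2) * (q + 1))
      + (k * (k - 1) * (k - 2) ^ 2 + k * (k - 1) * (q ^ 3 * (q ^ 2 + q + 1) - 2 * q ^ 2 * t)
        + q ^ 2 * k * (t * (t - 1))) + k * W < 0 := by
  have b1 : |c| ≤ 12 := abs_le.2 ⟨by linarith, by linarith⟩
  obtain ⟨c1, c2, c3, c4, c5, c6⟩ := pow_bounds c b1
  have key := poly_neg q hq ((-1) + (-1) * c ^ 1) ((795) + (7) * c ^ 1)
    ((-808) + (-5) * c ^ 1 + (5) * c ^ 2) ((2387) + (-785) * c ^ 1 + (-14) * c ^ 2 + (1) * c ^ 3)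
    ((-2430) + (1636) * c ^ 1 + (8) * c ^ 2 + (-5) * c ^ 3) ((780) + (-1608) * c ^ 1 + (-2) * c ^ 2 + (8) * c ^ 3 + (-1) * c ^ 4)
    ((-4) + (1640) * c ^ 1 + (-832) * c ^ 2 + (2) * c ^ 3 + (1) * c ^ 4) ((-32) + (40) * c ^ 1 + (800) * c ^ 2 + (-4) * c ^ 3) ((4) * c ^ 2)
    (by linarith) (by linarith) (by linarith) (by linarith) (by linarith) (by linarith) (by linarith)
    (by linarith) (by linarith)
  refine lt_of_eq_of_lt ?_ key
  rw [h1, h2, h3, h0, hW, hr, hB, hA, hk, ht]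
  ring

theorem quad_neg (α β γ a b x : ℝ) (hα : 0 ≤ α) (ha : α * a ^ 2 + β * a + γ < 0)
    (hb : α * b ^ 2 + β * b + γ < 0) (h1 : a ≤ x) (h2 : x ≤ b) : α * x ^ 2 + β * x + γ < 0 := by
  rcases h1.eq_or_lt with rfl | h1
  · exact ha
  have hab : 0 < b - a := by linarith
  have e : (b - a) * (α * x ^ 2 + β * x + γ) = (b - x) * (α * a ^ 2 + β * a + γ)
    + (x - a) * (α * b ^ 2 + β * b + γ) - (b - a) * (α * ((x - a) * (b - x))) := by ring
  have e1 : (b - x) * (α * a ^ 2 + β * a + γ) ≤ 0 :=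
    mul_nonpos_of_nonneg_of_nonpos (by linarith) ha.le
  have e2 : (x - a) * (α * b ^ 2 + β * b + γ) < 0 := mul_neg_of_pos_of_neg (by linarith) hb
  have e3 : 0 ≤ (b - a) * (α * ((x - a) * (b - x))) :=
    mul_nonneg hab.le (mul_nonneg hα (mul_nonneg (by linarith) (by linarith)))
  by_contra h
  push Not at h
  have := mul_nonneg hab.le h
  linarith

/-- the two windows for the number of tangents -/
theorem windows (q s t : ℝ) (hq : 2048 ≤ q) (hs : 0 ≤ s) (hsq : q = s ^ 2) (ht : 0 < t)
    (hT : t ≤ 3 * q ^ 2 - 3 * q * s - 7 * q + 9 * s + 8)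
    (H : ∀ c : ℤ, (q ^ 3 + q ^ 2 + q + 1 - t) * ((2 * c + 1) * t - c * (c + 1) * (q ^ 2 + q + 1)) ≤ q * (t * (t - 1))) :
    (q ^ 2 ≤ t ∧ t ≤ q ^ 2 + 3 * q) ∨ (2 * q ^ 2 - 7 * q ≤ t ∧ t ≤ 2 * q ^ 2 + 12 * q) := by
  have H0 := H 0
  have H1 := H 1
  have H2 := H 2
  norm_num at H0 H1 H2
  have hs45 : 45 ≤ s := by
    by_contra h; push Not at h; nlinarith
  have c0 : q ^ 2 ≤ t := by
    have : q ^ 3 + q ^ 2 + q + 1 - t ≤ q * (t - 1) := by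
      refine le_of_mul_le_mul_right ?_ ht
      linarith
    by_contra h; push Not at h
    nlinarith
  by_cases a1 : t ≤ q ^ 2 + 3 * q
  · exact Or.inl ⟨c0, a1⟩
  push Not at a1
  right
  constructor
  · by_contra h; push Not at h
    have := quad_neg (q + 3) (-q - 3 * (q ^ 3 + q ^ 2 + q + 1) - 2 * (q ^ 2 + q + 1))
      (2 * (q ^ 3 + q ^ 2 + q + 1) * (q ^ 2 + q + 1)) (q ^ 2 + 3 * q) (2 * q ^ 2 - 7 * q) t (by linarith)
      ?_ ?_ a1.le h.le
    · linarith
    · obtain ⟨x, hx, rfl⟩ : ∃ x : ℝ, 0 ≤ x ∧ q = 2048 + x := ⟨q - 2048, by linarith, by ring⟩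
      rw [← neg_pos]; ring_nf; positivity
    · obtain ⟨x, hx, rfl⟩ : ∃ x : ℝ, 0 ≤ x ∧ q = 2048 + x := ⟨q - 2048, by linarith, by ring⟩
      rw [← neg_pos]; ring_nf; positivity
  · by_contra h; push Not at h
    have := quad_neg (q + 5) (-q - 5 * (q ^ 3 + q ^ 2 + q + 1) - 6 * (q ^ 2 + q + 1))
      (6 * (q ^ 3 + q ^ 2 + q + 1) * (q ^ 2 + q + 1)) (2 * q ^ 2 + 12 * q)
      (3 * q ^ 2 - 3 * q * s - 7 * q + 9 * s + 8) t (by linarith)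
      ?_ ?_ h.le hT
    · linarith
    · obtain ⟨x, hx, rfl⟩ : ∃ x : ℝ, 0 ≤ x ∧ q = 2048 + x := ⟨q - 2048, by linarith, by ring⟩
      rw [← neg_pos]; ring_nf; positivity
    · rw [hsq]
      obtain ⟨x, hx, rfl⟩ : ∃ x : ℝ, 0 ≤ x ∧ s = 45 + x := ⟨s - 45, by linarith, by ring⟩
      rw [← neg_pos]; ring_nf; positivity

theorem thin_fat (q t h : ℝ) (hq : 2048 ≤ q) (ht0 : 0 ≤ t) (ht : t ≤ 2 * q ^ 2 + 12 * q)
    (hd : q * (h * (q ^ 2 + q + 2 - h)) ≤ t * (t - 1)) (h5 : 5 * q ≤ h) : q ^ 2 - 4 * q < h := by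
  by_contra hn; push Not at hn
  have e1 : 5 * q * (q ^ 2 - 4 * q + 2) ≤ h * (q ^ 2 + q + 2 - h) := by nlinarith
  have e2 : t * (t - 1) ≤ (2 * q ^ 2 + 12 * q) ^ 2 := by nlinarith
  have e3 := mul_le_mul_of_nonneg_left e1 (show 0 ≤ q by linarith)
  have e4 : q * (5 * q * (q ^ 2 - 4 * q + 2)) ≤ (2 * q ^ 2 + 12 * q) ^ 2 := by linarith
  obtain ⟨x, hx, rfl⟩ : ∃ x : ℝ, 0 ≤ x ∧ q = 2048 + x := ⟨q - 2048, by linarith, by ring⟩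
  have : 0 < (2048 + x) * (5 * (2048 + x) * ((2048 + x) ^ 2 - 4 * (2048 + x) + 2)) -
    (2 * (2048 + x) ^ 2 + 12 * (2048 + x)) ^ 2 := by ring_nf; positivity
  linarith

theorem thin_II2 (q c A B r h : ℝ) (hq : 2048 ≤ q) (hc1 : -3 ≤ c) (hc2 : c ≤ 12) (hA : A = q ^ 2 - q + 2 - c)
    (hB : B = q ^ 2 - 4 * q) (hr : r = 12 * q ^ 2 + 1000 * q) (h0 : 0 ≤ h) (h5 : h ≤ 5 * q) :
    0 ≤ (h - A) ^ 2 * (h ^ 2 - B * h + r) + h * (A ^ 2 * B - 12 * q ^ 5) := by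
  have q0 : 0 < q := by linarith
  have A1 : q ^ 2 - 2 * q ≤ A := by linarith
  have A2 : A ≤ q ^ 2 := by linarith
  have A0 : 0 ≤ q ^ 2 - 2 * q := by nlinarith
  have hh2 : h ^ 2 ≤ (5 * q) ^ 2 := pow_le_pow_left₀ h0 h5 2
  have hh3 : h ^ 3 ≤ (5 * q) ^ 3 := pow_le_pow_left₀ h0 h5 3
  have r0 : 0 ≤ r := by rw [hr]; positivity
  have Asq : (q ^ 2 - 2 * q) ^ 2 ≤ A ^ 2 := pow_le_pow_left₀ A0 A1 2
  have u1 : (q ^ 2 - 2 * q) ^ 2 * r ≤ A ^ 2 * r := mul_le_mul_of_nonneg_right Asq r0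
  have u2 : A * r * h ≤ q ^ 2 * r * (5 * q) :=
    mul_le_mul (mul_le_mul_of_nonneg_right A2 r0) h5 h0 (by positivity)
  have B0 : 0 ≤ B := by rw [hB]; nlinarith
  have u3 : ((q ^ 2 - 2 * q) ^ 2 + 2 * ((q ^ 2 - 2 * q) * B)) * h ^ 2 ≤ (A ^ 2 + 2 * (A * B)) * h ^ 2 :=
    mul_le_mul_of_nonneg_right (add_le_add Asq (mul_le_mul_of_nonneg_left
      (mul_le_mul_of_nonneg_right A1 B0) (by norm_num))) (by positivity)
  have u4 : (2 * A + B) * h ^ 3 ≤ 3 * q ^ 2 * (5 * q) ^ 3 :=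
    mul_le_mul (by linarith) hh3 (by positivity) (by positivity)
  have u5 : 0 ≤ r * h ^ 2 + h ^ 4 := by positivity
  have u6 : (16 * q ^ 3 - 20 * q ^ 2) * h ^ 2 ≤ (16 * q ^ 3 - 20 * q ^ 2) * (5 * q) ^ 2 :=
    mul_le_mul_of_nonneg_left hh2 (by nlinarith [pow_pos q0 2])
  have u7 : 0 ≤ 3 * q ^ 4 * (h - 2 * q) ^ 2 := by positivity
  have e : (h - A) ^ 2 * (h ^ 2 - B * h + r) + h * (A ^ 2 * B - 12 * q ^ 5) =
    A ^ 2 * r - 2 * (A * r * h) - 12 * q ^ 5 * h + (A ^ 2 + 2 * (A * B)) * h ^ 2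
      - (2 * A + B) * h ^ 3 + (r * h ^ 2 + h ^ 4) := by ring
  rw [e]
  have e3 : (q ^ 2 - 2 * q) ^ 2 + 2 * ((q ^ 2 - 2 * q) * B) = 3 * q ^ 4 - 16 * q ^ 3 + 20 * q ^ 2 := by
    rw [hB]; ring
  rw [e3] at u3
  rw [hr] at u1 u2
  have fin : 0 ≤ (q ^ 2 - 2 * q) ^ 2 * (12 * q ^ 2 + 1000 * q) - 12 * q ^ 6
      - 2 * (q ^ 2 * (12 * q ^ 2 + 1000 * q) * (5 * q))
      - (16 * q ^ 3 - 20 * q ^ 2) * (5 * q) ^ 2 - 3 * q ^ 2 * (5 * q) ^ 3 := by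
    obtain ⟨x, hx, rfl⟩ : ∃ x : ℝ, 0 ≤ x ∧ q = 2048 + x := ⟨q - 2048, by linarith, by ring⟩
    ring_nf; positivity
  rw [← hr] at u1 u2 fin
  linarith

theorem thin_II1 (q c A B r h : ℝ) (hq : 2048 ≤ q) (hc1 : 0 ≤ c) (hc2 : c ≤ 3) (hA : A = q ^ 2 + 2 - c)
    (hB : B = q ^ 2 - 4 * q) (hr : r = 3 * q ^ 2 + 800 * q) (h0 : 0 ≤ h) (h5 : h ≤ 5 * q) :
    0 ≤ (h - A) ^ 2 * (h ^ 2 - B * h + r) + h * (A ^ 2 * B - 6 * q ^ 5) := by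
  have q0 : 0 < q := by linarith
  have A1 : q ^ 2 - 1 ≤ A := by linarith
  have A2 : A ≤ q ^ 2 + 2 := by linarith
  have A0 : 0 ≤ q ^ 2 - 1 := by nlinarith
  have hh2 : h ^ 2 ≤ (5 * q) ^ 2 := pow_le_pow_left₀ h0 h5 2
  have hh3 : h ^ 3 ≤ (5 * q) ^ 3 := pow_le_pow_left₀ h0 h5 3
  have r0 : 0 ≤ r := by rw [hr]; positivity
  have Asq : (q ^ 2 - 1) ^ 2 ≤ A ^ 2 := pow_le_pow_left₀ A0 A1 2
  have u1 : (q ^ 2 - 1) ^ 2 * r ≤ A ^ 2 * r := mul_le_mul_of_nonneg_right Asq r0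
  have u2 : A * r * h ≤ (q ^ 2 + 2) * r * (5 * q) :=
    mul_le_mul (mul_le_mul_of_nonneg_right A2 r0) h5 h0 (by positivity)
  have B0 : 0 ≤ B := by rw [hB]; nlinarith
  have u3 : ((q ^ 2 - 1) ^ 2 + 2 * ((q ^ 2 - 1) * B)) * h ^ 2 ≤ (A ^ 2 + 2 * (A * B)) * h ^ 2 :=
    mul_le_mul_of_nonneg_right (add_le_add Asq (mul_le_mul_of_nonneg_left
      (mul_le_mul_of_nonneg_right A1 B0) (by norm_num))) (by positivity)
  have u4 : (2 * A + B) * h ^ 3 ≤ 3 * q ^ 2 * (5 * q) ^ 3 :=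
    mul_le_mul (by linarith) hh3 (by positivity) (by positivity)
  have u5 : 0 ≤ r * h ^ 2 + h ^ 4 := by positivity
  have u6 : (8 * q ^ 3 + 4 * q ^ 2 - 8 * q - 1) * h ^ 2 ≤ (8 * q ^ 3 + 4 * q ^ 2 - 8 * q - 1) * (5 * q) ^ 2 :=
    mul_le_mul_of_nonneg_left hh2 (by nlinarith [pow_pos q0 2, pow_pos q0 3])
  have u7 : 0 ≤ 3 * q ^ 4 * (h - q) ^ 2 := by positivity
  have e : (h - A) ^ 2 * (h ^ 2 - B * h + r) + h * (A ^ 2 * B - 6 * q ^ 5) =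
    A ^ 2 * r - 2 * (A * r * h) - 6 * q ^ 5 * h + (A ^ 2 + 2 * (A * B)) * h ^ 2
      - (2 * A + B) * h ^ 3 + (r * h ^ 2 + h ^ 4) := by ring
  rw [e]
  have e3 : (q ^ 2 - 1) ^ 2 + 2 * ((q ^ 2 - 1) * B) = 3 * q ^ 4 - 8 * q ^ 3 - 4 * q ^ 2 + 8 * q + 1 := by
    rw [hB]; ring
  rw [e3] at u3
  have fin : 0 ≤ (q ^ 2 - 1) ^ 2 * (3 * q ^ 2 + 800 * q) - 3 * q ^ 6
      - 2 * ((q ^ 2 + 2) * (3 * q ^ 2 + 800 * q) * (5 * q))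
      - (8 * q ^ 3 + 4 * q ^ 2 - 8 * q - 1) * (5 * q) ^ 2 - 3 * q ^ 2 * (5 * q) ^ 3 := by
    obtain ⟨x, hx, rfl⟩ : ∃ x : ℝ, 0 ≤ x ∧ q = 2048 + x := ⟨q - 2048, by linarith, by ring⟩
    ring_nf; positivity
  rw [← hr] at fin
  linarith

section cap
open Submodule
open scoped Classical
variable {F : Type*} [Field F] [Fintype F] {V : Type*} [AddCommGroup V] [Module F V] [Fintype V]
  {ι : Type*} [Fintype ι] {v : ι → V} [Fintype (Module.Dual F V)]

theorem core_case (hV : Module.finrank F V = 5) [CharP F 2] (hc : CapSys F V ι v) (i₀ : ι)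
    (q k t : ℝ) (hq : q = Fintype.card F) (hk : k = Fintype.card ι) (ht : t = q ^ 3 + q ^ 2 + q + 2 - k)
    (hq1 : 2048 ≤ q) (ht0 : 0 ≤ t) (ht1 : t ≤ 2 * q ^ 2 + 12 * q)
    (A B r W a0 a1 a2 a3 : ℝ) (φ : ℝ → ℝ) (hB : B = q ^ 2 - 4 * q) (hr : 0 ≤ r) (hW : 0 ≤ W)
    (h0 : a0 = A ^ 2 * r) (h3 : a3 = -2 * A - B + 5) (h2 : a2 = A ^ 2 + 2 * A * B + r - 8 + 3 * a3)
    (h1 : a1 = -(A ^ 2 * B) - 2 * A * r + 4 - 2 * a3 + a2)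
    (p0 : ∀ h, 0 ≤ h → h < 5 * q → 0 ≤ φ h)
    (p1 : ∀ h, 0 ≤ h → h < 5 * q → 0 ≤ (h - A) ^ 2 * (h ^ 2 - B * h + r) + h * φ h)
    (p2 : ∀ h, 0 ≤ h → h < 5 * q → φ h ≤ W)
    (p3 : ∀ h h', 0 ≤ h → h < 5 * q → 0 ≤ h' → h' < 5 * q → 2 * q ^ 2 + q + 3 - t ≤ h + h' → φ h + φ h' ≤ W) :
    0 ≤ a0 * (q ^ 4 + q ^ 3 + q ^ 2 + q + 1) + a1 * (k * (q ^ 3 + q ^ 2 + q + 1))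
      + a2 * (k * (k - 1) * (q ^ 2 + q + 1)) + a3 * (k * (k - 1) * (k - 2) * (q + 1))
      + (k * (k - 1) * (k - 2) ^ 2 + k * (k - 1) * (q ^ 3 * (q ^ 2 + q + 1) - 2 * q ^ 2 * t)
        + q ^ 2 * k * (t * (t - 1))) + k * W := by
  have n0 : ∀ f : Module.Dual F V, (0 : ℝ) ≤ hh v f := fun f => by exact_mod_cast hh_nonneg (v := v) f
  refine certificate hV hc q k t hq hk ht a0 a1 a2 a3 W
    (fun f => if (hh v f : ℝ) < 5 * q then φ (hh v f) else 0) ?_ ?_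
  · intro f hf
    have hd : q * ((hh v f : ℝ) * (q ^ 2 + q + 2 - hh v f)) ≤ t * (t - 1) := by
      have := dichotomy hV hc i₀ f hf
      rw [ht, hk, hq]
      exact_mod_cast this
    have hn := n0 f
    generalize (hh v f : ℝ) = h at *
    have e : a0 + a1 * h + a2 * (h * (h - 1)) + a3 * (h * (h - 1) * (h - 2)) + h * (h - 1) * (h - 2) ^ 2
        = (h - A) ^ 2 * (h ^ 2 - B * h + r) := by
      subst h1 h2 h3 h0; ring
    rw [e]
    split_ifs with h5
    · exact p1 h hn h5
    · push Not at h5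
      have hf := thin_fat q t h hq1 ht0 ht1 hd h5
      rw [← hB] at hf
      have : 0 ≤ h ^ 2 - B * h + r := by nlinarith
      rw [mul_zero, add_zero]
      exact mul_nonneg (sq_nonneg _) this
  · intro i
    set w : Module.Dual F V → ℝ := fun f => if (hh v f : ℝ) < 5 * q then φ (hh v f) else 0 with hw
    have hthin : ∀ f, (hh v f : ℝ) < 5 * q → w f = φ (hh v f) := fun f hf => by simp [hw, hf]
    have hsum : ∑ f ∈ Finset.univ.filter (fun f : Module.Dual F V => f ≠ 0 ∧ f (v i) = 0), w f
        = ∑ f ∈ (Finset.univ.filter (fun f : Module.Dual F V => f ≠ 0 ∧ f (v i) = 0)).filter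
          (fun f => (hh v f : ℝ) < 5 * q), w f := by
      symm
      apply Finset.sum_filter_of_ne
      intro f _ h
      by_contra h'
      exact h (by simp [hw, h'])
    rw [hsum, show q - 1 = (Fintype.card F : ℝ) - 1 by rw [hq]]
    have mem : ∀ f, f ∈ (Finset.univ.filter (fun f : Module.Dual F V => f ≠ 0 ∧ f (v i) = 0)).filter
          (fun f => (hh v f : ℝ) < 5 * q) → f ≠ 0 ∧ f (v i) = 0 ∧ (hh v f : ℝ) < 5 * q := by
      intro f hf
      simp only [Finset.mem_filter, Finset.mem_univ, true_and] at hf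
      exact ⟨hf.1.1, hf.1.2, hf.2⟩
    apply two_class_sum
    · intro f
      simp only [hw]
      split_ifs with h
      · exact p0 _ (n0 f) h
      · exact le_rfl
    · intro f hf; exact (mem f hf).1
    · intro c f hc'
      simp only [hw, hh_smul f c hc']
    · exact hW
    · intro f hf
      obtain ⟨_, _, h⟩ := mem f hf
      rw [hthin f h]; exact p2 _ (n0 f) h
    · intro f hf g hg hfg
      obtain ⟨a1, a2, a3⟩ := mem f hf
      obtain ⟨b1, b2, b3⟩ := mem g hg
      rw [hthin f a3, hthin g b3]
      apply p3 _ _ (n0 f) a3 (n0 g) b3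
      have := bonf2 hV hc a1 b1 hfg a2 b2
      rw [ht, hk, hq]
      exact_mod_cast this
    · intro f hf g hg e he hfg hfe hge
      obtain ⟨a1, a2, a3⟩ := mem f hf
      obtain ⟨b1, b2, b3⟩ := mem g hg
      obtain ⟨c1, c2, c3⟩ := mem e he
      have := bonf3 hV hc a1 b1 c1 hfg hfe hge a2 b2 c2
      have h : 3 * q ^ 2 + 3 - t ≤ (hh v f : ℝ) + hh v g + hh v e := by
        rw [ht, hk, hq]
        exact_mod_cast this
      nlinarith

set_option maxHeartbeats 1000000 in
theorem core (hV : Module.finrank F V = 5) [CharP F 2] (hc : CapSys F V ι v) (i₀ : ι)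
    (q k s : ℝ) (hq : q = Fintype.card F) (hk : k = Fintype.card ι) (hq1 : 2048 ≤ q)
    (hs : 0 ≤ s) (hsq : q = s ^ 2)
    (hkk : q ^ 3 - 2 * q ^ 2 + 3 * q * s + 8 * q - 9 * s - 6 ≤ k) : False := by
  obtain ⟨t, ht⟩ : ∃ t, t = q ^ 3 + q ^ 2 + q + 2 - k := ⟨_, rfl⟩
  have tp : 0 < t := by
    have h1 := t_nonneg hV hc i₀
    have h2 := t_ne_zero hV hc i₀ (by rw [hq] at hq1; exact_mod_cast hq1)
    have h3 := lt_of_le_of_ne h1 h2.symm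
    rw [ht, hk, hq]
    exact_mod_cast h3
  have q0 : 0 < q := by linarith
  have hk' : k = q ^ 3 + q ^ 2 + q + 2 - t := by linarith
  have W := windows q s t hq1 hs hsq tp (by linarith) (by
    intro c
    have := window hV hc i₀ c
    have h : (k - 1) * ((2 * (c : ℝ) + 1) * t - c * (c + 1) * (q ^ 2 + q + 1)) ≤ q * (t * (t - 1)) := by
      rw [ht, hk, hq]
      exact_mod_cast this
    have e : q ^ 3 + q ^ 2 + q + 1 - t = k - 1 := by linarith
    rw [e]; exact h)
  rcases W with ⟨w1, w2⟩ | ⟨w1, w2⟩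
  · obtain ⟨c, hc'⟩ : ∃ c, t = q ^ 2 + c * q := ⟨(t - q ^ 2) / q, by field_simp; ring⟩
    have c0 : 0 ≤ c := le_of_mul_le_mul_right (by linarith) q0
    have c3 : c ≤ 3 := le_of_mul_le_mul_right (by linarith) q0
    have F1 := final_II1 q c t k _ _ _ _ _ _ _ _ hq1 c0 c3 hc' hk' rfl rfl rfl rfl rfl rfl rfl rfl
    have A1 : q ^ 2 - 1 ≤ q ^ 2 + 2 - c := by linarith
    have C0 : 0 ≤ (q ^ 2 + 2 - c) ^ 2 * (q ^ 2 - 4 * q) - 6 * q ^ 5 := by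
      have := pow_le_pow_left₀ (by nlinarith) A1 2
      have B0 : 0 ≤ q ^ 2 - 4 * q := by nlinarith
      have := mul_le_mul_of_nonneg_right this B0
      have : 0 ≤ (q ^ 2 - 1) ^ 2 * (q ^ 2 - 4 * q) - 6 * q ^ 5 := by
        obtain ⟨x, hx, rfl⟩ : ∃ x : ℝ, 0 ≤ x ∧ q = 2048 + x := ⟨q - 2048, by linarith, by ring⟩
        ring_nf; positivity
      linarith
    refine absurd (core_case hV hc i₀ q k t hq hk ht hq1 tp.le (by nlinarith) _ _ _ _ _ _ _ _
      (fun _ => (q ^ 2 + 2 - c) ^ 2 * (q ^ 2 - 4 * q) - 6 * q ^ 5) rfl ?_ ?_ rfl rfl rfl rfl ?_ ?_ ?_ ?_) (not_le.2 F1)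
    · positivity
    · exact C0
    · intro _ _ _; exact C0
    · intro h h0 h5
      exact thin_II1 q c _ _ _ h hq1 c0 c3 rfl rfl rfl h0 h5.le
    · intro _ _ _; exact le_rfl
    · intro h h' _ _ _ _ _; nlinarith
  · obtain ⟨c, hc'⟩ : ∃ c, t = 2 * q ^ 2 + c * q := ⟨(t - 2 * q ^ 2) / q, by field_simp; ring⟩
    have c0 : -7 ≤ c := le_of_mul_le_mul_right (by linarith) q0
    have c12 : c ≤ 12 := le_of_mul_le_mul_right (by linarith) q0
    have A1 : q ^ 2 - 2 * q ≤ q ^ 2 - q + 2 - c := by linarith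
    have A2 : q ^ 2 - q + 2 - c ≤ q ^ 2 := by linarith
    have qsq : 2048 * q ≤ q ^ 2 := by rw [sq]; exact mul_le_mul_of_nonneg_right hq1 q0.le
    have B0 : 0 ≤ q ^ 2 - 4 * q := by linarith
    have A0 : 0 ≤ q ^ 2 - 2 * q := by linarith
    have AB := mul_le_mul_of_nonneg_right (pow_le_pow_left₀ A0 A1 2) B0
    rcases le_total (-3) c with c3 | c3
    · have F1 := final_II2 q c t k _ _ _ _ _ _ _ _ hq1 c3 c12 hc' hk' rfl rfl rfl rfl rfl rfl rfl rfl
      have C0 : 0 ≤ (q ^ 2 - q + 2 - c) ^ 2 * (q ^ 2 - 4 * q) - 12 * q ^ 5 := by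
        have : 0 ≤ (q ^ 2 - 2 * q) ^ 2 * (q ^ 2 - 4 * q) - 12 * q ^ 5 := by
          obtain ⟨x, hx, rfl⟩ : ∃ x : ℝ, 0 ≤ x ∧ q = 2048 + x := ⟨q - 2048, by linarith, by ring⟩
          ring_nf; positivity
        linarith
      refine absurd (core_case hV hc i₀ q k t hq hk ht hq1 tp.le w2 _ _ _ _ _ _ _ _
        (fun _ => (q ^ 2 - q + 2 - c) ^ 2 * (q ^ 2 - 4 * q) - 12 * q ^ 5) rfl ?_ ?_ rfl rfl rfl rfl ?_ ?_ ?_ ?_) (not_le.2 F1)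
      · positivity
      · linarith
      · intro _ _ _; exact C0
      · intro h h0 h5
        exact thin_II2 q c _ _ _ h hq1 c3 c12 rfl rfl rfl h0 h5.le
      · intro _ _ _; linarith
      · intro _ _ _ _ _ _ _; linarith
    · have F1 := final_I2 q c t k _ _ _ _ _ _ _ _ hq1 c0 c3 hc' hk' rfl rfl rfl rfl rfl rfl rfl rfl
      obtain ⟨A, hA⟩ : ∃ A, A = q ^ 2 - q + 2 - c := ⟨_, rfl⟩
      obtain ⟨B, hB⟩ : ∃ B, B = q ^ 2 - 4 * q := ⟨_, rfl⟩
      rw [← hA] at A1 A2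
      have q2 : 0 ≤ q ^ 2 := by positivity
      have hBq : B ≤ q ^ 2 := by linarith
      have B0' : 0 ≤ B := by linarith
      have A0' : 0 ≤ A := by linarith
      have single : A ^ 2 * B ≤ 2 * (A ^ 2 * B) - (A ^ 2 + 2 * A * B) * (q * (1 - c) + 3) + 150 * q ^ 4 := by
        have v1 : A ^ 2 ≤ (q ^ 2) ^ 2 := pow_le_pow_left₀ A0' A2 2
        have v2 : A * B ≤ q ^ 2 * q ^ 2 := mul_le_mul A2 hBq B0' q2
        have u1 : A ^ 2 + 2 * A * B ≤ 3 * q ^ 4 := by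
          have v3 : A ^ 2 + 2 * A * B ≤ (q ^ 2) ^ 2 + 2 * (q ^ 2 * q ^ 2) := by linarith
          refine v3.trans (le_of_eq ?_)
          ring
        have v4 : q * (1 - c) ≤ q * 8 := mul_le_mul_of_nonneg_left (by linarith) q0.le
        have v5 : 0 ≤ q * (1 - c) := mul_nonneg q0.le (by linarith)
        have u2 : q * (1 - c) + 3 ≤ 9 * q := by linarith
        have u3 : (A ^ 2 + 2 * A * B) * (q * (1 - c) + 3) ≤ 3 * q ^ 4 * (9 * q) :=
          mul_le_mul u1 u2 (by linarith) (by positivity)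
        rw [← hA, ← hB] at AB
        have : 0 ≤ (q ^ 2 - 2 * q) ^ 2 * (q ^ 2 - 4 * q) - 3 * q ^ 4 * (9 * q) + 150 * q ^ 4 := by
          obtain ⟨x, hx, rfl⟩ : ∃ x : ℝ, 0 ≤ x ∧ q = 2048 + x := ⟨q - 2048, by linarith, by ring⟩
          ring_nf; positivity
        rw [← hB] at this
        linarith
      have hAB0 : 0 ≤ A ^ 2 * B := by positivity
      have bh : ∀ h, h < 5 * q → 0 ≤ B - h := by intro h hh5; linarith
      rw [← hA, ← hB] at F1
      refine absurd (core_case hV hc i₀ q k t hq hk ht hq1 tp.le w2 A B 0 _ _ _ _ _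
        (fun h => (A - h) ^ 2 * (B - h)) hB ?_ ?_ rfl rfl rfl rfl ?_ ?_ ?_ ?_) (not_le.2 F1)
      · exact le_rfl
      · linarith
      · intro h h0 h5; exact mul_nonneg (sq_nonneg _) (bh h h5)
      · intro h h0 h5; apply le_of_eq; ring
      · intro h h0 h5
        refine le_trans ?_ single
        have hA5 : 0 ≤ A - h := by linarith
        exact mul_le_mul (pow_le_pow_left₀ hA5 (by linarith) 2) (by linarith) (bh h h5) (by positivity)
      · intro h h' h0 h5 h0' h5' hs'
        have e : ∀ x, 0 ≤ x → x < 5 * q →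
            (A - x) ^ 2 * (B - x) ≤ A ^ 2 * B - (A ^ 2 + 2 * A * B) * x + 75 * q ^ 4 := by
          intro x x0 x5
          have y1 : x ^ 2 ≤ (5 * q) ^ 2 := pow_le_pow_left₀ x0 x5.le 2
          have y2 : (2 * A + B) * x ^ 2 ≤ (3 * q ^ 2) * (5 * q) ^ 2 :=
            mul_le_mul (by linarith) y1 (by positivity) (by positivity)
          have y3 : 0 ≤ x ^ 3 := by positivity
          linarith [show (A - x) ^ 2 * (B - x) = A ^ 2 * B - (A ^ 2 + 2 * A * B) * x + (2 * A + B) * x ^ 2 - x ^ 3 by ring, show (3 * q ^ 2) * (5 * q) ^ 2 = 75 * q ^ 4 by ring]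
        have e1 := e h h0 h5
        have e2 := e h' h0' h5'
        have e3 : q * (1 - c) + 3 ≤ h + h' := by rw [hc'] at hs'; linarith
        have e4 := mul_le_mul_of_nonneg_left e3 (show 0 ≤ A ^ 2 + 2 * A * B by positivity)
        linarith

end cap

theorem coll3_iff {F : Type*} [Field F] {n : ℕ} (P Q R : PGPoint F n) :
    Coll3 P Q R ↔ ¬ LinearIndependent F ![P.rep, Q.rep, R.rep] := by
  have hs : P.submodule ⊔ Q.submodule ⊔ R.submodule =
      Submodule.span F (Set.range ![P.rep, Q.rep, R.rep]) := by
    rw [P.submodule_eq, Q.submodule_eq, R.submodule_eq, ← Submodule.span_union, ← Submodule.span_union]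
    congr 1
    ext x
    simp
  rw [linearIndependent_iff_card_le_finrank_span, Set.finrank, ← hs, Coll3]
  simp only [Fintype.card_fin, not_le]
  omega

theorem capsys_of_complete {F : Type*} [Field F] {n : ℕ} (K : Set (PGPoint F n)) (hK : IsCompleteCap K)
    (P₀ : PGPoint F n) (hP₀ : P₀ ∈ K) :
    CapSys F (Fin (n + 1) → F) K (fun P => P.1.rep) where
  ind := by
    intro i j l hij hil hjl α β γ h
    have h1 := hK.1 i i.2 j j.2 l l.2 (fun h => hij (Subtype.ext h)) (fun h => hil (Subtype.ext h))
      (fun h => hjl (Subtype.ext h))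
    rw [coll3_iff, not_not, Fintype.linearIndependent_iff] at h1
    have h2 := h1 ![α, β, γ] (by simpa [Fin.sum_univ_three] using h)
    exact ⟨h2 0, h2 1, h2 2⟩
  ind2 := by
    intro i j hij α β h
    have h1 : LinearIndependent F ![i.1.rep, j.1.rep] :=
      Projectivization.linearIndependent_pair_iff_ne.2 (fun h => hij (Subtype.ext h))
    rw [Fintype.linearIndependent_iff] at h1
    have h2 := h1 ![α, β] (by simpa [Fin.sum_univ_two] using h)
    exact ⟨h2 0, h2 1⟩
  ne := fun i => i.1.rep_nonzero
  compl := by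
    intro y
    by_cases hy : y = 0
    · exact Or.inl ⟨⟨P₀, hP₀⟩, by rw [hy]; exact Submodule.zero_mem _⟩
    obtain ⟨P, hP⟩ : ∃ P : PGPoint F n, P = Projectivization.mk F y hy := ⟨_, rfl⟩
    have hyP : y ∈ Submodule.span F {P.rep} := by
      rw [← P.submodule_eq, hP, Projectivization.submodule_mk]
      exact Submodule.mem_span_singleton_self y
    by_cases hPK : P ∈ K
    · exact Or.inl ⟨⟨P, hPK⟩, hyP⟩
    right
    have key : ∀ Q ∈ K, ∀ R ∈ K, Q ≠ R → Coll3 P Q R →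
        ∃ i j : K, i ≠ j ∧ y ∈ Submodule.span F {i.1.rep, j.1.rep} := by
      intro Q hQ R hR hQR hc
      refine ⟨⟨Q, hQ⟩, ⟨R, hR⟩, fun h => hQR (congrArg Subtype.val h), ?_⟩
      have h1 : LinearIndependent F ![Q.rep, R.rep] :=
        Projectivization.linearIndependent_pair_iff_ne.2 hQR
      rw [coll3_iff] at hc
      have h2 : P.rep ∈ Submodule.span F (Set.range ![Q.rep, R.rep]) := by
        by_contra h
        exact hc (linearIndependent_finCons.2 ⟨h1, h⟩)
      rw [Matrix.range_cons, Matrix.range_cons, Matrix.range_empty, Set.union_empty] at h2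
      have h3 : Submodule.span F {P.rep} ≤ Submodule.span F {Q.rep, R.rep} := by
        rw [Submodule.span_singleton_le_iff_mem]
        exact h2
      exact h3 hyP
    have hn := hK.2 P hPK
    unfold IsCap at hn
    push Not at hn
    obtain ⟨P₁, h1, P₂, h2, P₃, h3, h12, h13, h23, hc⟩ := hn
    rcases h1 with rfl | h1
    · exact key P₂ (h2.resolve_left (Ne.symm h12)) P₃ (h3.resolve_left (Ne.symm h13)) h23 hc
    rcases h2 with rfl | h2
    · refine key P₁ h1 P₃ (h3.resolve_left (Ne.symm h23)) h13 ?_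
      unfold Coll3 at hc ⊢
      rwa [sup_comm P₂.submodule]
    rcases h3 with rfl | h3
    · refine key P₁ h1 P₂ h2 h12 ?_
      unfold Coll3 at hc ⊢
      rwa [sup_assoc, sup_comm P₃.submodule]
    exact absurd hc (hK.1 P₁ h1 P₂ h2 P₃ h3 h12 h13 h23)

theorem stmt3 (F : Type*) [Field F] [Fintype F] (q : ℕ) (hcard : Fintype.card F = q)
    (hqeven : Even q) (hq : 2048 ≤ q)
    (K : Set (PGPoint F 4)) (hK : IsCompleteCap K)
    (hk : (q : ℝ) ^ 3 - 2 * (q : ℝ) ^ 2 + 3 * (q : ℝ) * Real.sqrt q + 8 * (q : ℝ) - 9 * Real.sqrt q - 6 ≤ (K.ncard : ℝ)) :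
    ¬ ∃ δ : Submodule F (Fin 5 → F), Module.finrank F δ = 4 ∧
      (q : ℝ) ^ 2 - 2 * (q : ℝ) + 3 * Real.sqrt q + 2 ≤ ((ptsIn δ ∩ K).ncard : ℝ) ∧
      (ptsIn δ ∩ K).ncard < q ^ 2 + 1 := by
  rintro -
  have hq' : (2048 : ℝ) ≤ q := by exact_mod_cast hq
  have hs0 := Real.sqrt_nonneg (q : ℝ)
  have hsq : (q : ℝ) = Real.sqrt q ^ 2 := (Real.sq_sqrt (by linarith)).symm
  have hpos : (0 : ℝ) < K.ncard := by
    refine lt_of_lt_of_le ?_ hk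
    have h1 : Real.sqrt q ≤ q := by
      rw [Real.sqrt_le_left (by linarith)]
      nlinarith
    have h2 : (2048 : ℝ) * (q : ℝ) ^ 2 ≤ (q : ℝ) ^ 3 := by
      rw [pow_succ (q : ℝ) 2, mul_comm]
      exact mul_le_mul_of_nonneg_left hq' (by positivity)
    have h3 : 0 ≤ 3 * (q : ℝ) * Real.sqrt q := by positivity
    nlinarith
  have hne : K.Nonempty := by
    rw [Set.nonempty_iff_ne_empty]
    rintro rfl
    simp at hpos
  obtain ⟨P₀, hP₀⟩ := hne
  have hcs := capsys_of_complete K hK P₀ hP₀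
  haveI : CharP F 2 := by
    obtain ⟨p, hp⟩ := CharP.exists F
    haveI := hp
    obtain ⟨m, hpp, hm⟩ := FiniteField.card F p
    have h2 : 2 ∣ p ^ (m : ℕ) := by
      rw [← hm, hcard]; exact hqeven.two_dvd
    have h3 : 2 = p := (Nat.prime_dvd_prime_iff_eq Nat.prime_two hpp).1 (Nat.prime_two.dvd_of_dvd_pow h2)
    rw [h3]; exact hp
  haveI : Finite (PGPoint F 4) := Projectivization.finite_of_finite F (Fin (4 + 1) → F)
  letI : Fintype K := Fintype.ofFinite K
  haveI : Finite (Module.Dual F (Fin 5 → F)) := Module.finite_of_finite F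
  letI : Fintype (Module.Dual F (Fin 5 → F)) := Fintype.ofFinite _
  letI : DecidableEq F := Classical.decEq F
  letI : Fintype (Fin 5 → F) := inferInstance
  have hKc : K.ncard = Fintype.card K := by
    rw [← Nat.card_coe_set_eq, Nat.card_eq_fintype_card]
  exact core (F := F) (V := Fin 5 → F) (ι := K) (by simp) hcs ⟨P₀, hP₀⟩ (q : ℝ) (K.ncard : ℝ) (Real.sqrt q)
    (by rw [hcard]) (by rw [hKc]) hq' hs0 hsq hk
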